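/- arXiv:1409.2148 — 5 statements merged into one kernel-verified Lean document; each statement's English description precedes it below -/
import Mathlib

section
/- If (M, 1, ⊗, Φ) is a semistrict monoidal 2-category, then M together with the unit object 1, the tensor product (restricted to the strict 2-functors L_A = A ⊗ − and R_A = − ⊗ A), and the underlying interchangor 2-isomorphisms φ_{f,g} := Φ_{(f,id),(id,g)} is a stringent monoidal 2-category; that is, the φ_{f,g} are invertible and satisfy the stringent axioms (vi), (vii), (viii) and (ix). -/
open CategoryTheory Bicategory

universe w v u

/-- The data underlying a semistrict monoidal 2-category: a strict 2-category `M`,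
a unit object, a tensor product on objects, 1-morphisms and 2-morphisms, and
composition coherence 2-isomorphisms `Φ`. -/
structure SemistrictData (M : Type u) [Bicategory.{w, v} M] [Bicategory.Strict M] where
  one : M
  t : M → M → M
  tHom : ∀ {A A' B B' : M}, (A ⟶ A') → (B ⟶ B') → (t A B ⟶ t A' B')
  tCell : ∀ {A A' B B' : M} {f f' : A ⟶ A'} {g g' : B ⟶ B'},
    (f ⟶ f') → (g ⟶ g') → (tHom f g ⟶ tHom f' g')
  Φ : ∀ {A A' A'' B B' B'' : M} (f : A ⟶ A') (f' : A' ⟶ A'') (g : B ⟶ B') (g' : B' ⟶ B''),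
    tHom f g ≫ tHom f' g' ≅ tHom (f ≫ f') (g ≫ g')

/-- The axioms making `SemistrictData` into a semistrict monoidal 2-category, i.e. a monoid in
`(2Cat^ps, ×)` whose tensor product pseudofunctor is cubical. -/
structure IsSemistrict {M : Type u} [Bicategory.{w, v} M] [Bicategory.Strict M]
    (D : SemistrictData M) : Prop where
  /- the tensor product is a pseudofunctor: functoriality on hom-categories -/
  tHom_id : ∀ A B : M, D.tHom (𝟙 A) (𝟙 B) = 𝟙 (D.t A B)
  tCell_id : ∀ {A A' B B' : M} (f : A ⟶ A') (g : B ⟶ B'),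
    D.tCell (𝟙 f) (𝟙 g) = 𝟙 (D.tHom f g)
  tCell_comp : ∀ {A A' B B' : M} {f f' f'' : A ⟶ A'} {g g' g'' : B ⟶ B'}
    (α : f ⟶ f') (α' : f' ⟶ f'') (β : g ⟶ g') (β' : g' ⟶ g''),
    D.tCell (α ≫ α') (β ≫ β') = D.tCell α β ≫ D.tCell α' β'
  /- naturality of the composition coherence isomorphisms -/
  Φ_natural : ∀ {A A' A'' B B' B'' : M} {f f₂ : A ⟶ A'} {f' f₂' : A' ⟶ A''}
    {g g₂ : B ⟶ B'} {g' g₂' : B' ⟶ B''}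
    (α : f ⟶ f₂) (α' : f' ⟶ f₂') (β : g ⟶ g₂) (β' : g' ⟶ g₂'),
    ((D.tCell α β ▷ D.tHom f' g') ≫ (D.tHom f₂ g₂ ◁ D.tCell α' β')) ≫ (D.Φ f₂ f₂' g₂ g₂').hom
      = (D.Φ f f' g g').hom ≫ D.tCell ((α ▷ f') ≫ (f₂ ◁ α')) ((β ▷ g') ≫ (g₂ ◁ β'))
  /- coherence (associativity) of the composition coherence isomorphisms -/
  Φ_coherence : ∀ {A A' A'' A''' B B' B'' B''' : M}
    (f : A ⟶ A') (f' : A' ⟶ A'') (f'' : A'' ⟶ A''')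
    (g : B ⟶ B') (g' : B' ⟶ B'') (g'' : B'' ⟶ B''')
    (E₀ : (D.tHom f g ≫ D.tHom f' g') ≫ D.tHom f'' g''
            = D.tHom f g ≫ (D.tHom f' g' ≫ D.tHom f'' g''))
    (E₁ : D.tHom (f ≫ f' ≫ f'') (g ≫ g' ≫ g'')
            = D.tHom ((f ≫ f') ≫ f'') ((g ≫ g') ≫ g'')),
    eqToHom E₀ ≫ (D.tHom f g ◁ (D.Φ f' f'' g' g'').hom)
        ≫ (D.Φ f (f' ≫ f'') g (g' ≫ g'')).hom ≫ eqToHom E₁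
      = ((D.Φ f f' g g').hom ▷ D.tHom f'' g'') ≫ (D.Φ (f ≫ f') f'' (g ≫ g') g'').hom
  /- the cubical condition: `Φ` is an identity whenever the second 1-morphism of the first pair,
  or the first 1-morphism of the second pair, is an identity -/
  cubical_fst_eq : ∀ {A A' B B' B'' : M} (f : A ⟶ A') (g : B ⟶ B') (g' : B' ⟶ B''),
    D.tHom f g ≫ D.tHom (𝟙 A') g' = D.tHom (f ≫ 𝟙 A') (g ≫ g')
  cubical_fst : ∀ {A A' B B' B'' : M} (f : A ⟶ A') (g : B ⟶ B') (g' : B' ⟶ B''),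
    (D.Φ f (𝟙 A') g g').hom = eqToHom (cubical_fst_eq f g g')
  cubical_snd_eq : ∀ {A A' A'' B B'' : M} (f : A ⟶ A') (f' : A' ⟶ A'') (g' : B ⟶ B''),
    D.tHom f (𝟙 B) ≫ D.tHom f' g' = D.tHom (f ≫ f') (𝟙 B ≫ g')
  cubical_snd : ∀ {A A' A'' B B'' : M} (f : A ⟶ A') (f' : A' ⟶ A'') (g' : B ⟶ B''),
    (D.Φ f f' (𝟙 B) g').hom = eqToHom (cubical_snd_eq f f' g')
  /- the monoid structure in `(2Cat^ps, ×)` is strictly associative and strictly unital -/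
  t_assoc : ∀ A B C : M, D.t (D.t A B) C = D.t A (D.t B C)
  t_one_left : ∀ A : M, D.t D.one A = A
  t_one_right : ∀ A : M, D.t A D.one = A
  tHom_assoc : ∀ {A A' B B' C C' : M} (f : A ⟶ A') (g : B ⟶ B') (h : C ⟶ C'),
    HEq (D.tHom (D.tHom f g) h) (D.tHom f (D.tHom g h))
  tHom_one_left : ∀ {B B' : M} (g : B ⟶ B'), HEq (D.tHom (𝟙 D.one) g) g
  tHom_one_right : ∀ {A A' : M} (f : A ⟶ A'), HEq (D.tHom f (𝟙 D.one)) f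
  tCell_assoc : ∀ {A A' B B' C C' : M} {f f' : A ⟶ A'} {g g' : B ⟶ B'} {h h' : C ⟶ C'}
    (α : f ⟶ f') (β : g ⟶ g') (γ : h ⟶ h'),
    HEq (D.tCell (D.tCell α β) γ) (D.tCell α (D.tCell β γ))
  tCell_one_left : ∀ {B B' : M} {g g' : B ⟶ B'} (β : g ⟶ g'),
    HEq (D.tCell (𝟙 (𝟙 D.one)) β) β
  tCell_one_right : ∀ {A A' : M} {f f' : A ⟶ A'} (α : f ⟶ f'),
    HEq (D.tCell α (𝟙 (𝟙 D.one))) α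
  Φ_assoc_compat : ∀ {A A' A'' B B' B'' C C' C'' : M}
    (f : A ⟶ A') (f' : A' ⟶ A'') (g : B ⟶ B') (g' : B' ⟶ B'')
    (h : C ⟶ C') (h' : C' ⟶ C''),
    HEq ((D.Φ (D.tHom f g) (D.tHom f' g') h h').hom
          ≫ D.tCell (D.Φ f f' g g').hom (𝟙 (h ≫ h')))
        ((D.Φ f f' (D.tHom g h) (D.tHom g' h')).hom
          ≫ D.tCell (𝟙 (f ≫ f')) (D.Φ g g' h h').hom)
/-- The data underlying a stringent monoidal 2-category: a strict 2-category `M`, a unit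
object, a tensor product on objects, left- and right-tensor 2-functors `L_A = A ⊗ −` and
`R_A = − ⊗ A`, and interchangor 2-isomorphisms
`φ_{f,g} : (f ⊗ id_{B'}) ∘ (id_A ⊗ g) ⇒ (id_{A'} ⊗ g) ∘ (f ⊗ id_B)`. -/
structure StringentData (M : Type u) [Bicategory.{w, v} M] [Bicategory.Strict M] where
  one : M
  t : M → M → M
  L : ∀ (A : M) {B B' : M}, (B ⟶ B') → (t A B ⟶ t A B')
  R : ∀ (A : M) {B B' : M}, (B ⟶ B') → (t B A ⟶ t B' A)
  L₂ : ∀ (A : M) {B B' : M} {g g' : B ⟶ B'}, (g ⟶ g') → (L A g ⟶ L A g')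
  R₂ : ∀ (A : M) {B B' : M} {g g' : B ⟶ B'}, (g ⟶ g') → (R A g ⟶ R A g')
  φ : ∀ {A A' B B' : M} (f : A ⟶ A') (g : B ⟶ B'),
    (L A g ≫ R B' f) ≅ (R B f ≫ L A' g)

/-- The axioms of a stringent monoidal 2-category. -/
structure IsStringent {M : Type u} [Bicategory.{w, v} M] [Bicategory.Strict M]
    (D : StringentData M) : Prop where
  /- the tensor product of objects is strictly associative and strictly unital -/
  t_assoc : ∀ A B C : M, D.t (D.t A B) C = D.t A (D.t B C)
  t_one_left : ∀ A : M, D.t D.one A = A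
  t_one_right : ∀ A : M, D.t A D.one = A
  /- `L A` and `R A` are strict 2-functors -/
  L_id : ∀ A B : M, D.L A (𝟙 B) = 𝟙 (D.t A B)
  L_comp : ∀ (A : M) {B B' B'' : M} (g : B ⟶ B') (g' : B' ⟶ B''),
    D.L A (g ≫ g') = D.L A g ≫ D.L A g'
  R_id : ∀ A B : M, D.R A (𝟙 B) = 𝟙 (D.t B A)
  R_comp : ∀ (A : M) {B B' B'' : M} (g : B ⟶ B') (g' : B' ⟶ B''),
    D.R A (g ≫ g') = D.R A g ≫ D.R A g'
  L₂_id : ∀ (A : M) {B B' : M} (g : B ⟶ B'), D.L₂ A (𝟙 g) = 𝟙 (D.L A g)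
  L₂_comp : ∀ (A : M) {B B' : M} {g g' g'' : B ⟶ B'} (η : g ⟶ g') (θ : g' ⟶ g''),
    D.L₂ A (η ≫ θ) = D.L₂ A η ≫ D.L₂ A θ
  R₂_id : ∀ (A : M) {B B' : M} (g : B ⟶ B'), D.R₂ A (𝟙 g) = 𝟙 (D.R A g)
  R₂_comp : ∀ (A : M) {B B' : M} {g g' g'' : B ⟶ B'} (η : g ⟶ g') (θ : g' ⟶ g''),
    D.R₂ A (η ≫ θ) = D.R₂ A η ≫ D.R₂ A θ
  L₂_whiskerLeft : ∀ (A : M) {B B' B'' : M} (g : B ⟶ B') {h h' : B' ⟶ B''} (η : h ⟶ h')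
    (e₁ : D.L A (g ≫ h) = D.L A g ≫ D.L A h)
    (e₂ : D.L A g ≫ D.L A h' = D.L A (g ≫ h')),
    D.L₂ A (g ◁ η) = eqToHom e₁ ≫ (D.L A g ◁ D.L₂ A η) ≫ eqToHom e₂
  L₂_whiskerRight : ∀ (A : M) {B B' B'' : M} {g g' : B ⟶ B'} (η : g ⟶ g') (h : B' ⟶ B'')
    (e₁ : D.L A (g ≫ h) = D.L A g ≫ D.L A h)
    (e₂ : D.L A g' ≫ D.L A h = D.L A (g' ≫ h)),
    D.L₂ A (η ▷ h) = eqToHom e₁ ≫ (D.L₂ A η ▷ D.L A h) ≫ eqToHom e₂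
  R₂_whiskerLeft : ∀ (A : M) {B B' B'' : M} (g : B ⟶ B') {h h' : B' ⟶ B''} (η : h ⟶ h')
    (e₁ : D.R A (g ≫ h) = D.R A g ≫ D.R A h)
    (e₂ : D.R A g ≫ D.R A h' = D.R A (g ≫ h')),
    D.R₂ A (g ◁ η) = eqToHom e₁ ≫ (D.R A g ◁ D.R₂ A η) ≫ eqToHom e₂
  R₂_whiskerRight : ∀ (A : M) {B B' B'' : M} {g g' : B ⟶ B'} (η : g ⟶ g') (h : B' ⟶ B'')
    (e₁ : D.R A (g ≫ h) = D.R A g ≫ D.R A h)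
    (e₂ : D.R A g' ≫ D.R A h = D.R A (g' ≫ h)),
    D.R₂ A (η ▷ h) = eqToHom e₁ ≫ (D.R₂ A η ▷ D.R A h) ≫ eqToHom e₂
  /- `L_A L_B = L_{A⊗B}`, `R_B R_A = R_{A⊗B}` and `L_A R_B = R_B L_A`, on 1- and 2-morphisms -/
  L_L : ∀ (A B : M) {C C' : M} (g : C ⟶ C'), HEq (D.L (D.t A B) g) (D.L A (D.L B g))
  R_R : ∀ (A B : M) {C C' : M} (f : C ⟶ C'), HEq (D.R (D.t A B) f) (D.R B (D.R A f))
  L_R : ∀ (A B : M) {C C' : M} (f : C ⟶ C'), HEq (D.L A (D.R B f)) (D.R B (D.L A f))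
  L_L₂ : ∀ (A B : M) {C C' : M} {g g' : C ⟶ C'} (η : g ⟶ g'),
    HEq (D.L₂ (D.t A B) η) (D.L₂ A (D.L₂ B η))
  R_R₂ : ∀ (A B : M) {C C' : M} {f f' : C ⟶ C'} (η : f ⟶ f'),
    HEq (D.R₂ (D.t A B) η) (D.R₂ B (D.R₂ A η))
  L_R₂ : ∀ (A B : M) {C C' : M} {f f' : C ⟶ C'} (η : f ⟶ f'),
    HEq (D.L₂ A (D.R₂ B η)) (D.R₂ B (D.L₂ A η))
  /- the unit object is a strict unit for the tensor product 2-functors -/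
  L_one : ∀ {B B' : M} (g : B ⟶ B'), HEq (D.L D.one g) g
  R_one : ∀ {B B' : M} (g : B ⟶ B'), HEq (D.R D.one g) g
  L₂_one : ∀ {B B' : M} {g g' : B ⟶ B'} (η : g ⟶ g'), HEq (D.L₂ D.one η) η
  R₂_one : ∀ {B B' : M} {g g' : B ⟶ B'} (η : g ⟶ g'), HEq (D.R₂ D.one η) η
  /- axiom (vi): compatibility of the interchangor with tensoring by objects -/
  phi_tensor_left : ∀ (A : M) {B B' C C' : M} (g : B ⟶ B') (h : C ⟶ C'),
    HEq ((D.φ (D.L A g) h).hom) (D.L₂ A (D.φ g h).hom)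
  phi_tensor_middle : ∀ {A A' : M} (f : A ⟶ A') (B : M) {C C' : M} (h : C ⟶ C'),
    HEq ((D.φ (D.R B f) h).hom) ((D.φ f (D.L B h)).hom)
  phi_tensor_right : ∀ {A A' B B' : M} (f : A ⟶ A') (g : B ⟶ B') (C : M),
    HEq ((D.φ f (D.R C g)).hom) (D.R₂ C (D.φ f g).hom)
  /- axiom (vii): the interchangor is trivial on identities -/
  phi_id_right : ∀ {A A' : M} (f : A ⟶ A') (B : M)
    (e : D.L A (𝟙 B) ≫ D.R B f = D.R B f ≫ D.L A' (𝟙 B)),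
    (D.φ f (𝟙 B)).hom = eqToHom e
  phi_id_left : ∀ (A : M) {B B' : M} (g : B ⟶ B')
    (e : D.L A g ≫ D.R B' (𝟙 A) = D.R B (𝟙 A) ≫ D.L A g),
    (D.φ (𝟙 A) g).hom = eqToHom e
  /- axiom (viii): naturality of the interchangor in each variable -/
  phi_natural_fst : ∀ {A A' B B' : M} {f f₂ : A ⟶ A'} (α : f ⟶ f₂) (g : B ⟶ B'),
    (D.φ f g).hom ≫ (D.R₂ B α ▷ D.L A' g)
      = (D.L A g ◁ D.R₂ B' α) ≫ (D.φ f₂ g).hom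
  phi_natural_snd : ∀ {A A' B B' : M} (f : A ⟶ A') {g g₂ : B ⟶ B'} (β : g ⟶ g₂),
    (D.φ f g).hom ≫ (D.R B f ◁ D.L₂ A' β)
      = (D.L₂ A β ▷ D.R B' f) ≫ (D.φ f g₂).hom
  /- axiom (ix): decomposition of the interchangor over composition in each variable -/
  phi_comp_snd : ∀ {A A' B B' B'' : M} (f : A ⟶ A') (g : B ⟶ B') (g' : B' ⟶ B'')
    (e₁ : D.L A (g ≫ g') ≫ D.R B'' f = D.L A g ≫ (D.L A g' ≫ D.R B'' f))
    (e₂ : D.L A g ≫ (D.R B' f ≫ D.L A' g') = (D.L A g ≫ D.R B' f) ≫ D.L A' g')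
    (e₃ : (D.R B f ≫ D.L A' g) ≫ D.L A' g' = D.R B f ≫ D.L A' (g ≫ g')),
    (D.φ f (g ≫ g')).hom
      = eqToHom e₁ ≫ (D.L A g ◁ (D.φ f g').hom) ≫ eqToHom e₂
          ≫ ((D.φ f g).hom ▷ D.L A' g') ≫ eqToHom e₃
  phi_comp_fst : ∀ {A A' A'' B B' : M} (f : A ⟶ A') (f' : A' ⟶ A'') (g : B ⟶ B')
    (e₁ : D.L A g ≫ D.R B' (f ≫ f') = (D.L A g ≫ D.R B' f) ≫ D.R B' f')
    (e₂ : (D.R B f ≫ D.L A' g) ≫ D.R B' f' = D.R B f ≫ (D.L A' g ≫ D.R B' f'))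
    (e₃ : D.R B f ≫ (D.R B f' ≫ D.L A'' g) = D.R B (f ≫ f') ≫ D.L A'' g),
    (D.φ (f ≫ f') g).hom
      = eqToHom e₁ ≫ ((D.φ f g).hom ▷ D.R B' f') ≫ eqToHom e₂
          ≫ (D.R B f ◁ (D.φ f' g).hom) ≫ eqToHom e₃
namespace SSHelp

variable {M : Type u} [Bicategory.{w, v} M] [Bicategory.Strict M]

theorem whiskerLeft_one {A B : M} {f g : A ⟶ B} (α : f ⟶ g) : HEq (𝟙 A ◁ α) α := by
  rw [id_whiskerLeft, Strict.leftUnitor_eqToIso, Strict.leftUnitor_eqToIso]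
  simp

theorem whiskerRight_one {A B : M} {f g : A ⟶ B} (α : f ⟶ g) : HEq (α ▷ 𝟙 B) α := by
  rw [whiskerRight_id, Strict.rightUnitor_eqToIso, Strict.rightUnitor_eqToIso]
  simp

theorem id2 {A B : M} {f g : A ⟶ B} (α : f ⟶ g) : 𝟙 f ≫ α = α := Category.id_comp α

theorem comp2 {A B : M} {f g : A ⟶ B} (α : f ⟶ g) : α ≫ 𝟙 g = α := Category.comp_id α

theorem assoc2 {A B : M} {f g h k : A ⟶ B} (α : f ⟶ g) (β : g ⟶ h) (γ : h ⟶ k) :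
    (α ≫ β) ≫ γ = α ≫ β ≫ γ := Category.assoc α β γ

theorem id_heq {C : Type*} [Category C] {X Y : C} (h : X = Y) : HEq (𝟙 X) (𝟙 Y) := by
  subst h; rfl

theorem tCell_heq (D : SemistrictData M) {A A' B B' : M} {f f' k k' : A ⟶ A'}
    {g g' l l' : B ⟶ B'} {α : f ⟶ f'} {β : g ⟶ g'} {γ : k ⟶ k'} {δ : l ⟶ l'}
    (h1 : f = k) (h2 : f' = k') (h3 : g = l) (h4 : g' = l') (h5 : HEq α γ) (h6 : HEq β δ) :
    HEq (D.tCell α β) (D.tCell γ δ) := by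
  subst h1 h2 h3 h4; cases h5; cases h6; rfl

theorem Φ_heq (D : SemistrictData M) {A A' A'' B B' B'' : M} {f k : A ⟶ A'} {f' k' : A' ⟶ A''}
    {g l : B ⟶ B'} {g' l' : B' ⟶ B''} (h1 : f = k) (h2 : f' = k') (h3 : g = l) (h4 : g' = l') :
    HEq (D.Φ f f' g g').hom (D.Φ k k' l l').hom := by
  subst h1 h2 h3 h4; rfl

theorem wL_heq {A B C : M} {f f₂ : A ⟶ B} {g h g₂ h₂ : B ⟶ C} {α : g ⟶ h} {β : g₂ ⟶ h₂}
    (h0 : f = f₂) (h1 : g = g₂) (h2 : h = h₂) (h3 : HEq α β) : HEq (f ◁ α) (f₂ ◁ β) := by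
  subst h0 h1 h2; cases h3; rfl

theorem wR_heq {A B C : M} {f f₂ : B ⟶ C} {g h g₂ h₂ : A ⟶ B} {α : g ⟶ h} {β : g₂ ⟶ h₂}
    (h0 : f = f₂) (h1 : g = g₂) (h2 : h = h₂) (h3 : HEq α β) : HEq (α ▷ f) (β ▷ f₂) := by
  subst h0 h1 h2; cases h3; rfl


theorem tCell_eq_right {D : SemistrictData M} (hD : IsSemistrict D)
    {A A' B B' : M} (f : A ⟶ A') {g g' : B ⟶ B'} (h : g = g') :
    D.tCell (𝟙 f) (eqToHom h) = eqToHom (by rw [h]) := by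
  subst h; simp [hD.tCell_id]

theorem tCell_eq_left {D : SemistrictData M} (hD : IsSemistrict D)
    {A A' B B' : M} {f f' : A ⟶ A'} (h : f = f') (g : B ⟶ B') :
    D.tCell (eqToHom h) (𝟙 g) = eqToHom (by rw [h]) := by
  subst h; simp [hD.tCell_id]

/-- naturality, first cubical case -/
theorem nat_fst {D : SemistrictData M} (hD : IsSemistrict D)
    {A A' B B' B'' : M} {f f₂ : A ⟶ A'} {g g₂ : B ⟶ B'} {g' g₂' : B' ⟶ B''}
    (α : f ⟶ f₂) (β : g ⟶ g₂) (β' : g' ⟶ g₂') :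
    HEq (D.tCell α β ▷ D.tHom (𝟙 A') g' ≫ D.tHom f₂ g₂ ◁ D.tCell (𝟙 (𝟙 A')) β')
      (D.tCell α (β ▷ g' ≫ g₂ ◁ β')) := by
  have h := hD.Φ_natural α (𝟙 (𝟙 A')) β β'
  rw [hD.cubical_fst, hD.cubical_fst] at h
  have h' := heq_of_eq h
  rw [comp_eqToHom_heq_iff, heq_eqToHom_comp_iff] at h'
  refine h'.trans (tCell_heq D (Strict.comp_id _) (Strict.comp_id _) rfl rfl ?_ HEq.rfl)
  rw [whiskerLeft_id]
  exact (heq_of_eq (Category.comp_id _)).trans (whiskerRight_one α)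

theorem nat_snd {D : SemistrictData M} (hD : IsSemistrict D)
    {A A' A'' B B'' : M} {f f₂ : A ⟶ A'} {f' f₂' : A' ⟶ A''} {g g₂ : B ⟶ B''}
    (α : f ⟶ f₂) (α' : f' ⟶ f₂') (β : g ⟶ g₂) :
    HEq (D.tCell α (𝟙 (𝟙 B)) ▷ D.tHom f' g ≫ D.tHom f₂ (𝟙 B) ◁ D.tCell α' β)
      (D.tCell (α ▷ f' ≫ f₂ ◁ α') β) := by
  have h := hD.Φ_natural α α' (𝟙 (𝟙 B)) β
  rw [hD.cubical_snd, hD.cubical_snd] at h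
  have h' := heq_of_eq h
  rw [comp_eqToHom_heq_iff, heq_eqToHom_comp_iff] at h'
  refine h'.trans (tCell_heq D rfl rfl (Strict.id_comp _) (Strict.id_comp _) HEq.rfl ?_)
  rw [id_whiskerRight]
  exact (heq_of_eq (Category.id_comp _)).trans (whiskerLeft_one β)

theorem L_comp {D : SemistrictData M} (hD : IsSemistrict D)
    (A : M) {B B' B'' : M} (g : B ⟶ B') (g' : B' ⟶ B'') :
    D.tHom (𝟙 A) (g ≫ g') = D.tHom (𝟙 A) g ≫ D.tHom (𝟙 A) g' := by
  rw [hD.cubical_fst_eq, Strict.comp_id]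

theorem R_comp {D : SemistrictData M} (hD : IsSemistrict D)
    (A : M) {B B' B'' : M} (g : B ⟶ B') (g' : B' ⟶ B'') :
    D.tHom (g ≫ g') (𝟙 A) = D.tHom g (𝟙 A) ≫ D.tHom g' (𝟙 A) := by
  rw [hD.cubical_snd_eq, Strict.comp_id]


theorem split_snd {D : SemistrictData M} (hD : IsSemistrict D)
    {A A' B B' B'' : M} (f : A ⟶ A') (g : B ⟶ B') (g' : B' ⟶ B'') :
    HEq (D.Φ (𝟙 A) f g g').hom ((D.Φ (𝟙 A) f g (𝟙 B')).hom ▷ D.tHom (𝟙 A') g') := by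
  have h := heq_of_eq (hD.Φ_coherence (𝟙 A) f (𝟙 A') g (𝟙 B') g'
    (Strict.assoc _ _ _) (by simp only [Strict.assoc]))
  rw [hD.cubical_snd, hD.cubical_fst, whiskerLeft_eqToHom, heq_comp_eqToHom_iff,
    eqToHom_comp_heq_iff, eqToHom_comp_heq_iff, comp_eqToHom_heq_iff] at h
  exact (Φ_heq D rfl (Strict.comp_id f).symm rfl (Strict.id_comp g').symm).trans h

theorem split_fst {D : SemistrictData M} (hD : IsSemistrict D)
    {A A' A'' B B' : M} (f : A ⟶ A') (f' : A' ⟶ A'') (g : B ⟶ B') :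
    HEq (D.Φ f f' g (𝟙 B')).hom (D.tHom f (𝟙 B) ◁ (D.Φ (𝟙 A') f' g (𝟙 B')).hom) := by
  have h := heq_of_eq (hD.Φ_coherence f (𝟙 A') f' (𝟙 B) g (𝟙 B')
    (Strict.assoc _ _ _) (by simp only [Strict.assoc]))
  rw [hD.cubical_snd, hD.cubical_fst, eqToHom_whiskerRight, eqToHom_trans,
    eqToHom_comp_heq_iff, comp_eqToHom_heq_iff, heq_eqToHom_comp_iff] at h
  exact (Φ_heq D (Strict.comp_id f).symm rfl (Strict.id_comp g).symm rfl).trans h.symm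

theorem comp_snd {D : SemistrictData M} (hD : IsSemistrict D)
    {A A' B B' B'' : M} (f : A ⟶ A') (g : B ⟶ B') (g' : B' ⟶ B'')
    (E : D.tHom (𝟙 A) g ≫ D.tHom (𝟙 A ≫ f) (g' ≫ 𝟙 B'')
      = (D.tHom (𝟙 A) g ≫ D.tHom f (𝟙 B')) ≫ D.tHom (𝟙 A') g') :
    HEq (D.Φ (𝟙 A) f (g ≫ g') (𝟙 B'')).hom
      ((D.tHom (𝟙 A) g ◁ (D.Φ (𝟙 A) f g' (𝟙 B'')).hom) ≫ eqToHom E ≫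
        ((D.Φ (𝟙 A) f g (𝟙 B')).hom ▷ D.tHom (𝟙 A') g')) := by
  have h := heq_of_eq (hD.Φ_coherence (𝟙 A) (𝟙 A) f g g' (𝟙 B'')
    (Strict.assoc _ _ _) (by simp only [Strict.assoc]))
  rw [hD.cubical_fst, eqToHom_whiskerRight, eqToHom_comp_heq_iff, heq_eqToHom_comp_iff] at h
  refine (Φ_heq D (Strict.comp_id _).symm rfl rfl rfl).trans (h.symm.trans ?_)
  refine heq_comp rfl rfl ?_ HEq.rfl ?_
  · rw [hD.cubical_fst_eq]
    simp only [Strict.comp_id, Strict.id_comp]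
  · rw [comp_eqToHom_heq_iff, heq_eqToHom_comp_iff]
    exact (Φ_heq D rfl (Strict.id_comp f) rfl (Strict.comp_id g')).trans (split_snd hD f g g')

theorem comp_fst {D : SemistrictData M} (hD : IsSemistrict D)
    {A A' A'' B B' : M} (f : A ⟶ A') (f' : A' ⟶ A'') (g : B ⟶ B')
    (E : D.tHom (𝟙 A ≫ f) (g ≫ 𝟙 B') ≫ D.tHom f' (𝟙 B')
      = D.tHom f (𝟙 B) ≫ D.tHom (𝟙 A') g ≫ D.tHom f' (𝟙 B')) :
    HEq (D.Φ (𝟙 A) (f ≫ f') g (𝟙 B')).hom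
      (((D.Φ (𝟙 A) f g (𝟙 B')).hom ▷ D.tHom f' (𝟙 B')) ≫ eqToHom E ≫
        (D.tHom f (𝟙 B) ◁ (D.Φ (𝟙 A') f' g (𝟙 B')).hom)) := by
  have h := heq_of_eq (hD.Φ_coherence (𝟙 A) f f' g (𝟙 B') (𝟙 B')
    (Strict.assoc _ _ _) (by simp only [Strict.assoc]))
  rw [hD.cubical_snd, whiskerLeft_eqToHom, eqToHom_comp_heq_iff, eqToHom_comp_heq_iff,
    comp_eqToHom_heq_iff] at h
  refine (Φ_heq D rfl rfl rfl (Strict.comp_id _).symm).trans (h.trans ?_)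
  refine heq_comp rfl rfl ?_ HEq.rfl ?_
  · rw [hD.cubical_snd_eq]
    simp only [Strict.comp_id, Strict.id_comp]
  · rw [heq_eqToHom_comp_iff]
    exact (Φ_heq D (Strict.id_comp f) rfl (Strict.comp_id g) rfl).trans (split_fst hD f f' g)

end SSHelp

/-- If `(M, 1, ⊗, Φ)` is a semistrict monoidal 2-category, then `M` together
with the unit object, the tensor product (restricted to the strict 2-functors `L_A = A ⊗ −`
and `R_A = − ⊗ A`) and the underlying interchangor 2-isomorphisms `φ_{f,g} := Φ_{(f,id),(id,g)}`
is a stringent monoidal 2-category. -/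
theorem semistrict_toStringent
    {M : Type u} [Bicategory.{w, v} M] [Bicategory.Strict M]
    (D : SemistrictData M) (hD : IsSemistrict D)
    (e : ∀ {A A' B B' : M} (f : A ⟶ A') (g : B ⟶ B'),
      D.tHom (𝟙 A ≫ f) (g ≫ 𝟙 B') = D.tHom f (𝟙 B) ≫ D.tHom (𝟙 A') g) :
    IsStringent
      { one := D.one
        t := D.t
        L := fun A {_ _} g => D.tHom (𝟙 A) g
        R := fun A {_ _} f => D.tHom f (𝟙 A)
        L₂ := fun A {_ _} {_ _} η => D.tCell (𝟙 (𝟙 A)) η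
        R₂ := fun A {_ _} {_ _} η => D.tCell η (𝟙 (𝟙 A))
        φ := fun {A _ B B'} f g => D.Φ (𝟙 A) f g (𝟙 B') ≪≫ eqToIso (e f g) } := by
  have hphi : ∀ {A A' B B' : M} (f : A ⟶ A') (g : B ⟶ B'),
      HEq (D.Φ (𝟙 A) f g (𝟙 B') ≪≫ eqToIso (e f g)).hom (D.Φ (𝟙 A) f g (𝟙 B')).hom := by
    intro A A' B B' f g
    rw [Iso.trans_hom, eqToIso.hom]
    exact comp_eqToHom_heq _ _
  constructor
  case t_assoc => exact hD.t_assoc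
  case t_one_left => exact hD.t_one_left
  case t_one_right => exact hD.t_one_right
  case L_id => exact hD.tHom_id
  case L_comp => exact SSHelp.L_comp hD
  case R_id => exact fun A B => hD.tHom_id B A
  case R_comp => exact SSHelp.R_comp hD
  case L₂_id => exact fun A {_ _} g => hD.tCell_id _ _
  case L₂_comp =>
    intro A B B' g g' g'' η θ
    have := hD.tCell_comp (𝟙 (𝟙 A)) (𝟙 (𝟙 A)) η θ
    rw [SSHelp.comp2] at this
    exact this
  case R₂_id => exact fun A {_ _} g => hD.tCell_id _ _
  case R₂_comp =>
    intro A B B' g g' g'' η θ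
    have := hD.tCell_comp η θ (𝟙 (𝟙 A)) (𝟙 (𝟙 A))
    rw [SSHelp.comp2] at this
    exact this
  case L₂_whiskerLeft =>
    intro A B B' B'' g h h' η e₁ e₂
    refine (conj_eqToHom_iff_heq' _ _ e₁ e₂).2 ?_
    have := SSHelp.nat_fst hD (𝟙 (𝟙 A)) (𝟙 g) η
    rw [hD.tCell_id, id_whiskerRight, id_whiskerRight, SSHelp.id2, SSHelp.id2] at this
    exact this.symm
  case L₂_whiskerRight =>
    intro A B B' B'' g g' η h e₁ e₂
    refine (conj_eqToHom_iff_heq' _ _ e₁ e₂).2 ?_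
    have := SSHelp.nat_fst hD (𝟙 (𝟙 A)) η (𝟙 h)
    rw [hD.tCell_id, whiskerLeft_id, whiskerLeft_id, SSHelp.comp2, SSHelp.comp2] at this
    exact this.symm
  case R₂_whiskerLeft =>
    intro A B B' B'' g h h' η e₁ e₂
    refine (conj_eqToHom_iff_heq' _ _ e₁ e₂).2 ?_
    have := SSHelp.nat_snd hD (𝟙 g) η (𝟙 (𝟙 A))
    rw [hD.tCell_id, id_whiskerRight, id_whiskerRight, SSHelp.id2, SSHelp.id2] at this
    exact this.symm
  case R₂_whiskerRight =>
    intro A B B' B'' g g' η h e₁ e₂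
    refine (conj_eqToHom_iff_heq' _ _ e₁ e₂).2 ?_
    have := SSHelp.nat_snd hD η (𝟙 h) (𝟙 (𝟙 A))
    rw [hD.tCell_id, whiskerLeft_id, whiskerLeft_id, SSHelp.comp2, SSHelp.comp2] at this
    exact this.symm
  case L_L =>
    intro A B C C' g
    have := hD.tHom_assoc (𝟙 A) (𝟙 B) g
    rw [hD.tHom_id] at this
    exact this
  case R_R =>
    intro A B C C' g
    have := hD.tHom_assoc g (𝟙 A) (𝟙 B)
    rw [hD.tHom_id] at this
    exact this.symm
  case L_R => exact fun A B {_ _} f => (hD.tHom_assoc (𝟙 A) f (𝟙 B)).symm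
  case L_L₂ =>
    intro A B C C' g g' η
    have := hD.tCell_assoc (𝟙 (𝟙 A)) (𝟙 (𝟙 B)) η
    rw [hD.tCell_id, hD.tHom_id] at this
    exact this
  case R_R₂ =>
    intro A B C C' g g' η
    have := hD.tCell_assoc η (𝟙 (𝟙 A)) (𝟙 (𝟙 B))
    rw [hD.tCell_id, hD.tHom_id] at this
    exact this.symm
  case L_R₂ => exact fun A B {_ _ _ _} η => (hD.tCell_assoc (𝟙 (𝟙 A)) η (𝟙 (𝟙 B))).symm
  case L_one => exact hD.tHom_one_left
  case R_one => exact hD.tHom_one_right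
  case L₂_one => exact hD.tCell_one_left
  case R₂_one => exact hD.tCell_one_right
  case phi_tensor_left =>
    intro A B B' C C' g h
    have := hD.Φ_assoc_compat (𝟙 A) (𝟙 A) (𝟙 B) g h (𝟙 C')
    rw [hD.cubical_fst, hD.cubical_fst, SSHelp.tCell_eq_left hD] at this
    replace this := (comp_eqToHom_heq _ _).symm.trans (this.trans (eqToHom_comp_heq _ _))
    refine (hphi _ _).trans ((SSHelp.Φ_heq D (hD.tHom_id A B).symm rfl rfl rfl).trans
      (this.trans (SSHelp.tCell_heq D (Strict.comp_id _) (Strict.comp_id _) rfl (e g h)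
        (SSHelp.id_heq (Strict.comp_id _)) (hphi g h).symm)))
  case phi_tensor_middle =>
    intro A A' f B C C' h
    have := hD.Φ_assoc_compat (𝟙 A) f (𝟙 B) (𝟙 B) h (𝟙 C')
    rw [hD.cubical_snd, hD.cubical_fst, SSHelp.tCell_eq_left hD, SSHelp.tCell_eq_right hD] at this
    replace this := (comp_eqToHom_heq _ _).symm.trans (this.trans (comp_eqToHom_heq _ _))
    refine (hphi _ _).trans ((SSHelp.Φ_heq D (hD.tHom_id A B).symm rfl rfl rfl).trans
      (this.trans ((SSHelp.Φ_heq D rfl rfl rfl (hD.tHom_id B C')).trans (hphi _ _).symm)))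
  case phi_tensor_right =>
    intro A A' B B' f g C
    have := hD.Φ_assoc_compat (𝟙 A) f g (𝟙 B') (𝟙 C) (𝟙 C)
    rw [hD.cubical_snd, hD.cubical_snd, SSHelp.tCell_eq_right hD] at this
    replace this := (eqToHom_comp_heq _ _).symm.trans (this.trans (comp_eqToHom_heq _ _))
    refine (hphi _ _).trans ((SSHelp.Φ_heq D rfl rfl rfl (hD.tHom_id B' C).symm).trans
      (this.symm.trans (SSHelp.tCell_heq D rfl (e f g) (Strict.comp_id _) (Strict.comp_id _)
        (hphi f g).symm (SSHelp.id_heq (Strict.comp_id _)))))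
  case phi_id_right =>
    intro A A' f B e'
    show (D.Φ (𝟙 A) f (𝟙 B) (𝟙 B) ≪≫ eqToIso _).hom = _
    rw [Iso.trans_hom, eqToIso.hom, hD.cubical_snd, eqToHom_trans]
  case phi_id_left =>
    intro A B B' g e'
    show (D.Φ (𝟙 A) (𝟙 A) g (𝟙 B') ≪≫ eqToIso _).hom = _
    rw [Iso.trans_hom, eqToIso.hom, hD.cubical_fst, eqToHom_trans]
  case phi_natural_fst =>
    intro A A' B B' f f₂ α g
    have h := hD.Φ_natural (𝟙 (𝟙 A)) α (𝟙 g) (𝟙 (𝟙 B'))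
    have h2 := SSHelp.nat_fst hD α (𝟙 (𝟙 B)) (𝟙 g)
    rw [hD.tCell_id, id_whiskerRight, id_whiskerRight, id_whiskerRight, whiskerLeft_id,
      SSHelp.id2, SSHelp.id2, SSHelp.id2] at h
    rw [hD.tCell_id, id_whiskerRight, whiskerLeft_id, whiskerLeft_id,
      SSHelp.comp2, SSHelp.comp2] at h2
    refine eq_of_heq ?_
    show HEq ((D.Φ (𝟙 A) f g (𝟙 B') ≪≫ eqToIso (e f g)).hom ≫ _)
      (_ ≫ (D.Φ (𝟙 A) f₂ g (𝟙 B') ≪≫ eqToIso (e f₂ g)).hom)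
    refine HEq.trans ?_ ((heq_of_eq h.symm).trans
      (heq_comp rfl rfl (e f₂ g) HEq.rfl (hphi f₂ g).symm))
    refine heq_comp rfl (e f g).symm (e f₂ g).symm (hphi f g) (h2.trans ?_)
    exact SSHelp.tCell_heq D (Strict.id_comp _).symm (Strict.id_comp _).symm
      ((Strict.id_comp _).trans (Strict.comp_id _).symm)
      ((Strict.id_comp _).trans (Strict.comp_id _).symm)
      (SSHelp.whiskerLeft_one α).symm
      (SSHelp.id_heq ((Strict.id_comp _).trans (Strict.comp_id _).symm))
  case phi_natural_snd =>
    intro A A' B B' f g g₂ β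
    have h := hD.Φ_natural (𝟙 (𝟙 A)) (𝟙 f) β (𝟙 (𝟙 B'))
    have h2 := SSHelp.nat_fst hD (𝟙 f) (𝟙 (𝟙 B)) β
    rw [hD.tCell_id, id_whiskerRight, whiskerLeft_id, whiskerLeft_id, whiskerLeft_id,
      SSHelp.comp2, SSHelp.comp2, SSHelp.comp2] at h
    rw [hD.tCell_id, id_whiskerRight, id_whiskerRight,
      SSHelp.id2, SSHelp.id2] at h2
    refine eq_of_heq ?_
    show HEq ((D.Φ (𝟙 A) f g (𝟙 B') ≪≫ eqToIso (e f g)).hom ≫ _)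
      (_ ≫ (D.Φ (𝟙 A) f g₂ (𝟙 B') ≪≫ eqToIso (e f g₂)).hom)
    refine HEq.trans ?_ ((heq_of_eq h.symm).trans
      (heq_comp rfl rfl (e f g₂) HEq.rfl (hphi f g₂).symm))
    refine heq_comp rfl (e f g).symm (e f g₂).symm (hphi f g) (h2.trans ?_)
    exact SSHelp.tCell_heq D (Strict.id_comp _).symm (Strict.id_comp _).symm
      ((Strict.id_comp _).trans (Strict.comp_id _).symm)
      ((Strict.id_comp _).trans (Strict.comp_id _).symm)
      (SSHelp.id_heq (Strict.id_comp _).symm)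
      ((SSHelp.whiskerLeft_one β).trans (SSHelp.whiskerRight_one β).symm)
  case phi_comp_snd =>
    intro A A' B B' B'' f g g' e₁ e₂ e₃
    refine eq_of_heq ?_
    show HEq (D.Φ (𝟙 A) f (g ≫ g') (𝟙 B'') ≪≫ eqToIso _).hom
      (eqToHom e₁ ≫ D.tHom (𝟙 A) g ◁ (D.Φ (𝟙 A) f g' (𝟙 B'') ≪≫ eqToIso _).hom ≫ eqToHom e₂ ≫
       (D.Φ (𝟙 A) f g (𝟙 B') ≪≫ eqToIso _).hom ▷ D.tHom (𝟙 A') g' ≫ eqToHom e₃)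
    have E : D.tHom (𝟙 A) g ≫ D.tHom (𝟙 A ≫ f) (g' ≫ 𝟙 B'')
      = (D.tHom (𝟙 A) g ≫ D.tHom f (𝟙 B')) ≫ D.tHom (𝟙 A') g' := by
      rw [e, e₂]
    have := SSHelp.comp_snd hD f g g' E
    simp only [Iso.trans_hom, eqToIso.hom, whiskerLeft_comp, comp_whiskerRight,
      whiskerLeft_eqToHom, eqToHom_whiskerRight, SSHelp.assoc2, eqToHom_trans,
      eqToHom_trans_assoc]
    rw [heq_eqToHom_comp_iff, comp_eqToHom_heq_iff, ← SSHelp.assoc2, ← SSHelp.assoc2,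
      heq_comp_eqToHom_iff, SSHelp.assoc2]
    exact this
  case phi_comp_fst =>
    intro A A' A'' B B' f f' g e₁ e₂ e₃
    refine eq_of_heq ?_
    show HEq (D.Φ (𝟙 A) (f ≫ f') g (𝟙 B') ≪≫ eqToIso _).hom
      (eqToHom e₁ ≫ (D.Φ (𝟙 A) f g (𝟙 B') ≪≫ eqToIso _).hom ▷ D.tHom f' (𝟙 B') ≫ eqToHom e₂ ≫
       D.tHom f (𝟙 B) ◁ (D.Φ (𝟙 A') f' g (𝟙 B') ≪≫ eqToIso _).hom ≫ eqToHom e₃)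
    have E : D.tHom (𝟙 A ≫ f) (g ≫ 𝟙 B') ≫ D.tHom f' (𝟙 B')
      = D.tHom f (𝟙 B) ≫ D.tHom (𝟙 A') g ≫ D.tHom f' (𝟙 B') := by
      rw [e, Strict.assoc]
    have := SSHelp.comp_fst hD f f' g E
    simp only [Iso.trans_hom, eqToIso.hom, whiskerLeft_comp, comp_whiskerRight,
      whiskerLeft_eqToHom, eqToHom_whiskerRight, SSHelp.assoc2, eqToHom_trans,
      eqToHom_trans_assoc]
    rw [heq_eqToHom_comp_iff, comp_eqToHom_heq_iff, ← SSHelp.assoc2, ← SSHelp.assoc2,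
      heq_comp_eqToHom_iff, SSHelp.assoc2]
    exact this
end

section
/- If (M, 1, ⊗, φ) is a stringent monoidal 2-category, then defining, for all f : A → A', f' : A' → A'', g : B → B', g' : B' → B'', the 2-isomorphism Φ_{(f',g'),(f,g)} := id_{id_{A''} ⊗ g'} ∗ φ_{f',g} ∗ id_{f ⊗ id_B} (the whiskering of φ_{f',g} above by id_{A''} ⊗ g' and below by f ⊗ id_B) makes ⊗ into a cubical pseudofunctor M × M → M and makes (M, 1, ⊗, Φ) a semistrict monoidal 2-category; in particular Φ is natural, satisfies the pseudofunctor coherence equation, is the identity whenever f' or g is an identity, and the resulting tensor product is strictly associative and unital. -/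
open CategoryTheory Bicategory

universe w v u

section abs
variable {M : Type u} [Bicategory.{w, v} M]

theorem abs_nat {a b c c' d e : M} {r r₂ : a ⟶ b} {l l₂ : b ⟶ c} {s s₂ : c ⟶ d} {k k₂ : d ⟶ e}
    {s0 s0₂ : b ⟶ c'} {l0 l0₂ : c' ⟶ d} (ρ : r ⟶ r₂) (lam : l ⟶ l₂) (σ : s ⟶ s₂) (κ : k ⟶ k₂)
    (σ0 : s0 ⟶ s0₂) (lam0 : l0 ⟶ l0₂) (p : l ≫ s ⟶ s0 ≫ l0) (p₂ : l₂ ≫ s₂ ⟶ s0₂ ≫ l0₂)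
    (H : (lam ▷ s ≫ l₂ ◁ σ) ≫ p₂ = p ≫ (σ0 ▷ l0 ≫ s0₂ ◁ lam0)) :
    (((ρ ▷ l ≫ r₂ ◁ lam) ▷ (s ≫ k)) ≫ ((r₂ ≫ l₂) ◁ (σ ▷ k ≫ s₂ ◁ κ))) ≫
      ((α_ r₂ l₂ (s₂ ≫ k₂)).hom ≫ r₂ ◁ (α_ l₂ s₂ k₂).inv) ≫ r₂ ◁ (p₂ ▷ k₂) ≫
      (r₂ ◁ (α_ s0₂ l0₂ k₂).hom ≫ (α_ r₂ s0₂ (l0₂ ≫ k₂)).inv) =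
    (((α_ r l (s ≫ k)).hom ≫ r ◁ (α_ l s k).inv) ≫ r ◁ (p ▷ k) ≫
      (r ◁ (α_ s0 l0 k).hom ≫ (α_ r s0 (l0 ≫ k)).inv)) ≫
      (((ρ ▷ s0 ≫ r₂ ◁ σ0) ▷ (l0 ≫ k)) ≫ ((r₂ ≫ s0₂) ◁ (lam0 ▷ k ≫ l0₂ ◁ κ))) := by
  calc _ = 𝟙 _ ⊗≫ ρ ▷ (l ≫ s ≫ k) ⊗≫ r₂ ◁ (lam ▷ s ≫ l₂ ◁ σ) ▷ k ⊗≫ r₂ ◁ ((l₂ ≫ s₂) ◁ κ ≫ p₂ ▷ k₂) ⊗≫ 𝟙 _ := by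
        bicategory
    _ = 𝟙 _ ⊗≫ ρ ▷ (l ≫ s ≫ k) ⊗≫ r₂ ◁ ((lam ▷ s ≫ l₂ ◁ σ) ≫ p₂) ▷ k ⊗≫ r₂ ◁ s0₂ ◁ l0₂ ◁ κ ⊗≫ 𝟙 _ := by
        rw [whisker_exchange]; bicategory
    _ = 𝟙 _ ⊗≫ (ρ ▷ (l ≫ s) ≫ r₂ ◁ p) ▷ k ⊗≫ r₂ ◁ (σ0 ▷ l0 ≫ s0₂ ◁ lam0) ▷ k ⊗≫ r₂ ◁ s0₂ ◁ l0₂ ◁ κ ⊗≫ 𝟙 _ := by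
        rw [H]; bicategory
    _ = _ := by
        rw [← whisker_exchange]; bicategory

end abs

section cellcalc
variable {M : Type u} [Bicategory.{w, v} M]

/-- equality of 1-cells with varying endpoints -/
inductive OEq {a b : M} (f : a ⟶ b) : ∀ {a' b' : M}, (a' ⟶ b') → Prop
  | refl : OEq f f

/-- equality of 2-cells with varying boundary -/
inductive CEq {a b : M} {f g : a ⟶ b} (η : f ⟶ g) :
    ∀ {a' b' : M} {f' g' : a' ⟶ b'}, (f' ⟶ g') → Prop
  | refl : CEq η η

namespace OEq
variable {a b c a' b' c' a'' b'' : M}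
theorem of_eq {f f' : a ⟶ b} (h : f = f') : OEq f f' := by subst h; exact .refl
theorem eq {f f' : a ⟶ b} (h : OEq f f') : f = f' := by cases h; rfl
theorem heq {f : a ⟶ b} {f' : a' ⟶ b'} (h : OEq f f') : HEq f f' := by cases h; rfl
theorem of_heq {f : a ⟶ b} {f' : a' ⟶ b'} (h₁ : a = a') (h₂ : b = b') (h : HEq f f') :
    OEq f f' := by
  subst h₁ h₂; cases h; exact .refl
theorem symm {f : a ⟶ b} {f' : a' ⟶ b'} (h : OEq f f') : OEq f' f := by cases h; exact .refl
theorem trans {f : a ⟶ b} {f' : a' ⟶ b'} {f'' : a'' ⟶ b''} (h : OEq f f') (h' : OEq f' f'') :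
    OEq f f'' := by cases h; exact h'
theorem comp {f : a ⟶ b} {f' : a' ⟶ b'} {g : b ⟶ c} {g' : b' ⟶ c'} (h : OEq f f')
    (h' : OEq g g') : OEq (f ≫ g) (f' ≫ g') := by cases h; cases h'; exact .refl
theorem id (h : a = a') : OEq (𝟙 a) (𝟙 a') := by subst h; exact .refl
end OEq

namespace CEq
variable {a b c d a' b' c' d' a'' b'' : M}
theorem of_eq {f g : a ⟶ b} {η θ : f ⟶ g} (h : η = θ) : CEq η θ := by subst h; exact .refl
theorem eq {f g : a ⟶ b} {η θ : f ⟶ g} (h : CEq η θ) : η = θ := by cases h; rfl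
theorem heq {f g : a ⟶ b} {η : f ⟶ g} {f' g' : a' ⟶ b'} {η' : f' ⟶ g'} (h : CEq η η') :
    HEq η η' := by cases h; rfl
theorem of_heq {f g : a ⟶ b} {η : f ⟶ g} {f' g' : a' ⟶ b'} {η' : f' ⟶ g'}
    (h₁ : OEq f f') (h₂ : OEq g g') (h : HEq η η') : CEq η η' := by
  cases h₁; cases h₂; cases h; exact .refl
theorem symm {f g : a ⟶ b} {η : f ⟶ g} {f' g' : a' ⟶ b'} {η' : f' ⟶ g'} (h : CEq η η') :
    CEq η' η := by cases h; exact .refl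
theorem trans {f g : a ⟶ b} {η : f ⟶ g} {f' g' : a' ⟶ b'} {η' : f' ⟶ g'}
    {f'' g'' : a'' ⟶ b''} {η'' : f'' ⟶ g''} (h : CEq η η') (h' : CEq η' η'') :
    CEq η η'' := by cases h; exact h'
theorem src {f g : a ⟶ b} {η : f ⟶ g} {f' g' : a' ⟶ b'} {η' : f' ⟶ g'} (h : CEq η η') :
    OEq f f' := by cases h; exact .refl
theorem tgt {f g : a ⟶ b} {η : f ⟶ g} {f' g' : a' ⟶ b'} {η' : f' ⟶ g'} (h : CEq η η') :
    OEq g g' := by cases h; exact .refl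
theorem id {f : a ⟶ b} {f' : a' ⟶ b'} (h : OEq f f') : CEq (𝟙 f) (𝟙 f') := by
  cases h; exact .refl
theorem comp {f g k : a ⟶ b} {η : f ⟶ g} {θ : g ⟶ k} {f' g' k' : a' ⟶ b'} {η' : f' ⟶ g'}
    {θ' : g' ⟶ k'} (h : CEq η η') (h' : CEq θ θ') : CEq (η ≫ θ) (η' ≫ θ') := by
  cases h; cases h'; exact .refl
theorem wl {f : a ⟶ b} {f' : a' ⟶ b'} {g k : b ⟶ c} {g' k' : b' ⟶ c'} {η : g ⟶ k}
    {η' : g' ⟶ k'} (h : OEq f f') (h' : CEq η η') : CEq (f ◁ η) (f' ◁ η') := by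
  cases h; cases h'; exact .refl
theorem wr {f : b ⟶ c} {f' : b' ⟶ c'} {g k : a ⟶ b} {g' k' : a' ⟶ b'} {η : g ⟶ k}
    {η' : g' ⟶ k'} (h' : CEq η η') (h : OEq f f') : CEq (η ▷ f) (η' ▷ f') := by
  cases h'; cases h; exact .refl

/-- `IsE η` : the 2-cell `η` is an identity up to equality of 1-cells -/
def _root_.IsE {f g : a ⟶ b} (η : f ⟶ g) : Prop := ∃ h : f = g, η = eqToHom h

theorem _root_.IsE.e {f g : a ⟶ b} (h : f = g) : IsE (eqToHom h) := ⟨h, rfl⟩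
theorem _root_.IsE.eh {f g : a ⟶ b} (h : f = g) : IsE (eqToIso h).hom := ⟨h, rfl⟩
theorem _root_.IsE.ei {f g : a ⟶ b} (h : f = g) : IsE (eqToIso h).inv := ⟨h.symm, rfl⟩
theorem _root_.IsE.id (f : a ⟶ b) : IsE (𝟙 f) := ⟨rfl, rfl⟩
theorem _root_.IsE.comp {f g k : a ⟶ b} {η : f ⟶ g} {θ : g ⟶ k} (h : IsE η) (h' : IsE θ) :
    IsE (η ≫ θ) := by
  obtain ⟨rfl, rfl⟩ := h; obtain ⟨rfl, rfl⟩ := h'; exact ⟨rfl, by simp⟩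
theorem _root_.IsE.wl (f : a ⟶ b) {g k : b ⟶ c} {η : g ⟶ k} (h : IsE η) : IsE (f ◁ η) := by
  obtain ⟨rfl, rfl⟩ := h; exact ⟨rfl, by simp⟩
theorem _root_.IsE.wr (f : b ⟶ c) {g k : a ⟶ b} {η : g ⟶ k} (h : IsE η) : IsE (η ▷ f) := by
  obtain ⟨rfl, rfl⟩ := h; exact ⟨rfl, by simp⟩
theorem _root_.IsE.ceq {f g : a ⟶ b} {η : f ⟶ g} (h : IsE η) : CEq η (𝟙 f) := by
  obtain ⟨rfl, rfl⟩ := h; exact .refl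
theorem _root_.IsE.ceq2 {f g : a ⟶ b} {η : f ⟶ g} (h : IsE η) {f' g' : a' ⟶ b'} {θ : f' ⟶ g'}
    (h' : IsE θ) (o : OEq f f') : CEq η θ := by
  obtain ⟨rfl, rfl⟩ := h; obtain ⟨rfl, rfl⟩ := h'; cases o; exact .refl
theorem dl {f g k : a ⟶ b} {ep : f ⟶ g} {θ : g ⟶ k} {f' g' : a' ⟶ b'} {θ' : f' ⟶ g'}
    (h : IsE ep) (h' : CEq θ θ') : CEq (ep ≫ θ) θ' := by
  obtain ⟨rfl, rfl⟩ := h; simpa using h'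
theorem dr {f g k : a ⟶ b} {ep : g ⟶ k} {θ : f ⟶ g} {f' g' : a' ⟶ b'} {θ' : f' ⟶ g'}
    (h' : CEq θ θ') (h : IsE ep) : CEq (θ ≫ ep) θ' := by
  obtain ⟨rfl, rfl⟩ := h; simpa using h'

/-- vertical composition across an equality of 1-cells -/
def _root_.vsq {f g g' k : a ⟶ b} (η : f ⟶ g) (h : g = g') (θ : g' ⟶ k) : f ⟶ k :=
  η ≫ eqToHom h ≫ θ

theorem mid {f g g₁ k : a ⟶ b} {η : f ⟶ g} {θ : g₁ ⟶ k} {f' g' g'' k' : a' ⟶ b'} {η' : f' ⟶ g'}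
    {θ' : g'' ⟶ k'} (h : CEq η η') (hg : g = g₁) (h' : CEq θ θ') : g' = g'' := by
  cases h; cases h'; exact hg
theorem toSq {f g k : a ⟶ b} {η : f ⟶ g} {θ : g ⟶ k} {f' g' g'' k' : a' ⟶ b'} {η' : f' ⟶ g'}
    {θ' : g'' ⟶ k'} (h : CEq η η') (h' : CEq θ θ') :
    CEq (η ≫ θ) (vsq η' (mid h rfl h') θ') := by
  cases h; cases h'; exact .of_eq (by simp [vsq])
theorem sqc {f g g₁ k : a ⟶ b} {η : f ⟶ g} {hg : g = g₁} {θ : g₁ ⟶ k} {f' g' g'' k' : a' ⟶ b'}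
    {η' : f' ⟶ g'} {θ' : g'' ⟶ k'} (h : CEq η η') (h' : CEq θ θ') :
    CEq (vsq η hg θ) (vsq η' (mid h hg h') θ') := by
  cases h; cases h'; exact .refl
theorem sqa {f g g' k k' l : a ⟶ b} (η : f ⟶ g) (h : g = g') (θ : g' ⟶ k) (h' : k = k')
    (ζ : k' ⟶ l) : CEq (vsq η h (vsq θ h' ζ)) (vsq (vsq η h θ) h' ζ) := by
  subst h h'; exact .of_eq (by simp [vsq])
theorem sq_rfl {f g k : a ⟶ b} (η : f ⟶ g) (h : g = g) (θ : g ⟶ k) : CEq (vsq η h θ) (η ≫ θ) :=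
  .of_eq (by simp [vsq])
theorem wl_sq (x : a ⟶ b) {f g g' k : b ⟶ c} (η : f ⟶ g) (h : g = g') (θ : g' ⟶ k) :
    CEq (x ◁ vsq η h θ) (vsq (x ◁ η) (congrArg (x ≫ ·) h) (x ◁ θ)) := by
  subst h; exact .of_eq (by simp [vsq])
theorem wr_sq (x : b ⟶ c) {f g g' k : a ⟶ b} (η : f ⟶ g) (h : g = g') (θ : g' ⟶ k) :
    CEq (vsq η h θ ▷ x) (vsq (η ▷ x) (congrArg (· ≫ x) h) (θ ▷ x)) := by
  subst h; exact .of_eq (by simp [vsq])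

end CEq

section strict
variable [Bicategory.Strict M] {a b c d e : M}
theorem IsE.ah (f : a ⟶ b) (g : b ⟶ c) (h : c ⟶ d) : IsE (α_ f g h).hom := by
  rw [Strict.associator_eqToIso]; exact .eh _
theorem IsE.ai (f : a ⟶ b) (g : b ⟶ c) (h : c ⟶ d) : IsE (α_ f g h).inv := by
  rw [Strict.associator_eqToIso]; exact .ei _
theorem OEq.assoc (f : a ⟶ b) (g : b ⟶ c) (h : c ⟶ d) : OEq ((f ≫ g) ≫ h) (f ≫ g ≫ h) :=
  .of_eq (Strict.assoc _ _ _)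
theorem CEq.wl2 (f : a ⟶ b) (g : b ⟶ c) {h h' : c ⟶ d} (η : h ⟶ h') :
    CEq ((f ≫ g) ◁ η) (f ◁ g ◁ η) := by
  rw [comp_whiskerLeft]; exact .dl (.ah ..) (.dr .refl (.ai ..))
theorem CEq.wr2 {h h' : a ⟶ b} (η : h ⟶ h') (f : b ⟶ c) (g : c ⟶ d) :
    CEq (η ▷ (f ≫ g)) (η ▷ f ▷ g) := by
  rw [whiskerRight_comp]; exact .dl (.ai ..) (.dr .refl (.ah ..))
theorem CEq.wm (f : a ⟶ b) {h h' : b ⟶ c} (η : h ⟶ h') (g : c ⟶ d) :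
    CEq ((f ◁ η) ▷ g) (f ◁ η ▷ g) := by
  rw [whisker_assoc]; exact .dl (.ah ..) (.dr .refl (.ai ..))
theorem CEq.idl {h h' : a ⟶ b} (η : h ⟶ h') : CEq (𝟙 a ◁ η) η := by
  rw [id_whiskerLeft, Strict.leftUnitor_eqToIso, Strict.leftUnitor_eqToIso]
  exact .dl (.eh _) (.dr .refl (.ei _))
theorem CEq.idr {h h' : a ⟶ b} (η : h ⟶ h') : CEq (η ▷ 𝟙 b) η := by
  rw [whiskerRight_id, Strict.rightUnitor_eqToIso, Strict.rightUnitor_eqToIso]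
  exact .dl (.eh _) (.dr .refl (.ei _))
end strict
end cellcalc

section stringent
variable {M : Type u} [Bicategory.{w, v} M] [Bicategory.Strict M]

theorem abs_tri {a b c d : M} {r r₂ : a ⟶ b} {l l₂ : b ⟶ c} {k k₂ : c ⟶ d} (x : r ⟶ r₂)
    (y : l ⟶ l₂) (z : k ⟶ k₂) :
    CEq ((x ▷ l ≫ r₂ ◁ y) ▷ k ≫ (r₂ ≫ l₂) ◁ z) (x ▷ (l ≫ k) ≫ r₂ ◁ (y ▷ k ≫ l₂ ◁ z)) := by
  have : (x ▷ l ≫ r₂ ◁ y) ▷ k ≫ (r₂ ≫ l₂) ◁ z =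
      (α_ _ _ _).hom ≫ (x ▷ (l ≫ k) ≫ r₂ ◁ (y ▷ k ≫ l₂ ◁ z)) ≫ (α_ _ _ _).inv := by
    bicategory
  rw [this]
  exact .dl (.ah ..) (.dr .refl (.ai ..))

theorem exch {a b c d e : M} (r : a ⟶ b) {x x' : b ⟶ c} {y y' : c ⟶ d} (m : d ⟶ e)
    (P : x ⟶ x') (Q : y ⟶ y') :
    r ◁ (x ◁ Q) ▷ m ≫ r ◁ (P ▷ y') ▷ m = r ◁ (P ▷ y) ▷ m ≫ r ◁ (x' ◁ Q) ▷ m := by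
  rw [← whiskerLeft_comp, ← comp_whiskerRight, whisker_exchange, comp_whiskerRight,
    whiskerLeft_comp]

theorem PhiC {a b c d : M} {x y : a ⟶ d} {r : a ⟶ b} {p q : b ⟶ c} {k : c ⟶ d} (i : p ≅ q)
    (h₁ : x = r ≫ p ≫ k) (h₂ : r ≫ q ≫ k = y) :
    CEq (eqToIso h₁ ≪≫ whiskerLeftIso r (whiskerRightIso i k) ≪≫ eqToIso h₂).hom
      (r ◁ i.hom ▷ k) :=
  .dl (.eh _) (.dr .refl (.eh _))

theorem glue {a b : M} {f g g' k l m : a ⟶ b} {x₁ : f ⟶ g} {x₂ : g ⟶ k} {y₁ : f ⟶ g'}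
    {y₂ : g' ⟶ k} (E : x₁ ≫ x₂ = y₁ ≫ y₂) (x₃ : l ⟶ m) (h : k = l) (h₁ : g = g) (h₂ : g' = g') :
    CEq (vsq x₁ h₁ (vsq x₂ h x₃)) (vsq y₁ h₂ (vsq y₂ h x₃)) := by
  subst h; exact .of_eq (by simp [vsq, reassoc_of% E])

theorem w1 {a b c d e z : M} (r : a ⟶ b) {p p' : b ⟶ c} (P : p ⟶ p') (q : c ⟶ d) (k : d ⟶ e)
    (m : e ⟶ z) : CEq (r ◁ (P ▷ q) ▷ (k ≫ m)) (r ◁ (P ▷ (q ≫ k)) ▷ m) :=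
  .wl .refl ((CEq.wr2 ..).trans (.wr (CEq.wr2 ..).symm .refl))
theorem w2 {a b c d e z : M} (r : a ⟶ b) (l : b ⟶ c) (s : c ⟶ d) {p p' : d ⟶ e} (P : p ⟶ p')
    (m : e ⟶ z) : CEq (r ◁ l ◁ s ◁ P ▷ m) (r ◁ ((l ≫ s) ◁ P) ▷ m) :=
  .wl .refl ((CEq.wl2 ..).symm.trans (CEq.wm ..).symm)
theorem w3 {a b c d : M} (r : a ⟶ b) {p q q' k : b ⟶ c} (X : p ⟶ q) (h : q = q') (Y : q' ⟶ k)
    (m : c ⟶ d) : CEq (r ◁ (vsq X h Y) ▷ m)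
      (vsq (r ◁ X ▷ m) (congrArg (r ≫ · ≫ m) h) (r ◁ Y ▷ m)) :=
  (CEq.wl .refl (CEq.wr_sq ..)).trans (CEq.wl_sq ..)

section
variable (D : StringentData M)
theorem OL {A A' B B' C C' : M} {g : B ⟶ B'} {g' : C ⟶ C'} (h : A = A') (o : OEq g g') :
    OEq (D.L A g) (D.L A' g') := by subst h; cases o; exact .refl
theorem OR {A A' B B' C C' : M} {g : B ⟶ B'} {g' : C ⟶ C'} (h : A = A') (o : OEq g g') :
    OEq (D.R A g) (D.R A' g') := by subst h; cases o; exact .refl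
theorem CL (A : M) {B B' C C' : M} {g k : B ⟶ B'} {g' k' : C ⟶ C'} {η : g ⟶ k} {η' : g' ⟶ k'}
    (o : CEq η η') : CEq (D.L₂ A η) (D.L₂ A η') := by cases o; exact .refl
theorem CR (A : M) {B B' C C' : M} {g k : B ⟶ B'} {g' k' : C ⟶ C'} {η : g ⟶ k} {η' : g' ⟶ k'}
    (o : CEq η η') : CEq (D.R₂ A η) (D.R₂ A η') := by cases o; exact .refl
end

variable {D : StringentData M}

theorem LLo (hD : IsStringent D) (A B : M) {C C' : M} (g : C ⟶ C') :
    OEq (D.L (D.t A B) g) (D.L A (D.L B g)) :=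
  .of_heq (hD.t_assoc ..) (hD.t_assoc ..) (hD.L_L ..)
theorem RRo (hD : IsStringent D) (A B : M) {C C' : M} (g : C ⟶ C') :
    OEq (D.R (D.t A B) g) (D.R B (D.R A g)) :=
  .of_heq (hD.t_assoc ..).symm (hD.t_assoc ..).symm (hD.R_R ..)
theorem LRo (hD : IsStringent D) (A B : M) {C C' : M} (g : C ⟶ C') :
    OEq (D.L A (D.R B g)) (D.R B (D.L A g)) :=
  .of_heq (hD.t_assoc ..).symm (hD.t_assoc ..).symm (hD.L_R ..)
theorem LLc (hD : IsStringent D) (A B : M) {C C' : M} {g g' : C ⟶ C'} (η : g ⟶ g') :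
    CEq (D.L₂ (D.t A B) η) (D.L₂ A (D.L₂ B η)) :=
  .of_heq (LLo hD ..) (LLo hD ..) (hD.L_L₂ ..)
theorem RRc (hD : IsStringent D) (A B : M) {C C' : M} {g g' : C ⟶ C'} (η : g ⟶ g') :
    CEq (D.R₂ (D.t A B) η) (D.R₂ B (D.R₂ A η)) :=
  .of_heq (RRo hD ..) (RRo hD ..) (hD.R_R₂ ..)
theorem LRc (hD : IsStringent D) (A B : M) {C C' : M} {g g' : C ⟶ C'} (η : g ⟶ g') :
    CEq (D.L₂ A (D.R₂ B η)) (D.R₂ B (D.L₂ A η)) :=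
  .of_heq (LRo hD ..) (LRo hD ..) (hD.L_R₂ ..)
theorem L1o (hD : IsStringent D) {C C' : M} (g : C ⟶ C') : OEq (D.L D.one g) g :=
  .of_heq (hD.t_one_left _) (hD.t_one_left _) (hD.L_one g)
theorem R1o (hD : IsStringent D) {C C' : M} (g : C ⟶ C') : OEq (D.R D.one g) g :=
  .of_heq (hD.t_one_right _) (hD.t_one_right _) (hD.R_one g)
theorem L1c (hD : IsStringent D) {C C' : M} {g g' : C ⟶ C'} (η : g ⟶ g') :
    CEq (D.L₂ D.one η) η :=
  .of_heq (L1o hD _) (L1o hD _) (hD.L₂_one η)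
theorem R1c (hD : IsStringent D) {C C' : M} {g g' : C ⟶ C'} (η : g ⟶ g') :
    CEq (D.R₂ D.one η) η :=
  .of_heq (R1o hD _) (R1o hD _) (hD.R₂_one η)
theorem Lco (hD : IsStringent D) (A : M) {B B' B'' : M} (g : B ⟶ B') (h : B' ⟶ B'') :
    OEq (D.L A (g ≫ h)) (D.L A g ≫ D.L A h) := .of_eq (hD.L_comp ..)
theorem Rco (hD : IsStringent D) (A : M) {B B' B'' : M} (g : B ⟶ B') (h : B' ⟶ B'') :
    OEq (D.R A (g ≫ h)) (D.R A g ≫ D.R A h) := .of_eq (hD.R_comp ..)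
theorem Lwl (hD : IsStringent D) (A : M) {B B' B'' : M} (g : B ⟶ B') {h h' : B' ⟶ B''}
    (η : h ⟶ h') : CEq (D.L₂ A (g ◁ η)) (D.L A g ◁ D.L₂ A η) := by
  rw [hD.L₂_whiskerLeft A g η (hD.L_comp ..) (hD.L_comp ..).symm]
  exact .dl (.e _) (.dr .refl (.e _))
theorem Lwr (hD : IsStringent D) (A : M) {B B' B'' : M} {g g' : B ⟶ B'} (η : g ⟶ g')
    (h : B' ⟶ B'') : CEq (D.L₂ A (η ▷ h)) (D.L₂ A η ▷ D.L A h) := by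
  rw [hD.L₂_whiskerRight A η h (hD.L_comp ..) (hD.L_comp ..).symm]
  exact .dl (.e _) (.dr .refl (.e _))
theorem Rwl (hD : IsStringent D) (A : M) {B B' B'' : M} (g : B ⟶ B') {h h' : B' ⟶ B''}
    (η : h ⟶ h') : CEq (D.R₂ A (g ◁ η)) (D.R A g ◁ D.R₂ A η) := by
  rw [hD.R₂_whiskerLeft A g η (hD.R_comp ..) (hD.R_comp ..).symm]
  exact .dl (.e _) (.dr .refl (.e _))
theorem Rwr (hD : IsStringent D) (A : M) {B B' B'' : M} {g g' : B ⟶ B'} (η : g ⟶ g')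
    (h : B' ⟶ B'') : CEq (D.R₂ A (η ▷ h)) (D.R₂ A η ▷ D.R A h) := by
  rw [hD.R₂_whiskerRight A η h (hD.R_comp ..) (hD.R_comp ..).symm]
  exact .dl (.e _) (.dr .refl (.e _))
theorem LcC (hD : IsStringent D) (A : M) {B B' : M} {f g k : B ⟶ B'} {x y z : D.t A B ⟶ D.t A B'}
    {η : f ⟶ g} {θ : g ⟶ k} {η' : x ⟶ y} {θ' : y ⟶ z} (h : CEq (D.L₂ A η) η')
    (h' : CEq (D.L₂ A θ) θ') : CEq (D.L₂ A (η ≫ θ)) (η' ≫ θ') := by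
  rw [hD.L₂_comp]; exact h.comp h'
theorem RcC (hD : IsStringent D) (A : M) {B B' : M} {f g k : B ⟶ B'} {x y z : D.t B A ⟶ D.t B' A}
    {η : f ⟶ g} {θ : g ⟶ k} {η' : x ⟶ y} {θ' : y ⟶ z} (h : CEq (D.R₂ A η) η')
    (h' : CEq (D.R₂ A θ) θ') : CEq (D.R₂ A (η ≫ θ)) (η' ≫ θ') := by
  rw [hD.R₂_comp]; exact h.comp h'

theorem phL (hD : IsStringent D) (A : M) {B B' C C' : M} (g : B ⟶ B') (h : C ⟶ C') :
    CEq (D.φ (D.L A g) h).hom (D.L₂ A (D.φ g h).hom) :=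
  .of_heq (((LLo hD ..).comp (LRo hD ..).symm).trans (Lco hD ..).symm)
    (((LRo hD ..).symm.comp (LLo hD ..)).trans (Lco hD ..).symm) (hD.phi_tensor_left ..)
theorem phM (hD : IsStringent D) {A A' : M} (f : A ⟶ A') (B : M) {C C' : M} (h : C ⟶ C') :
    CEq (D.φ (D.R B f) h).hom (D.φ f (D.L B h)).hom :=
  .of_heq ((LLo hD ..).comp (RRo hD ..).symm)
    ((RRo hD ..).symm.comp (LLo hD ..)) (hD.phi_tensor_middle ..)
theorem phR (hD : IsStringent D) {A A' B B' : M} (f : A ⟶ A') (g : B ⟶ B') (C : M) :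
    CEq (D.φ f (D.R C g)).hom (D.R₂ C (D.φ f g).hom) :=
  .of_heq (((LRo hD ..).comp (RRo hD ..)).trans (Rco hD ..).symm)
    (((RRo hD ..).comp (LRo hD ..)).trans (Rco hD ..).symm) (hD.phi_tensor_right ..)

theorem phS (hD : IsStringent D) {A A' B B' B'' : M} (f : A ⟶ A') (g : B ⟶ B') (g' : B' ⟶ B'') :
    CEq (D.φ f (g ≫ g')).hom
      (vsq (D.L A g ◁ (D.φ f g').hom) (Strict.assoc ..).symm ((D.φ f g).hom ▷ D.L A' g')) := by
  rw [hD.phi_comp_snd f g g' (by rw [hD.L_comp, Strict.assoc]) (Strict.assoc ..).symm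
    (by rw [hD.L_comp, Strict.assoc])]
  refine .dl (.e _) ?_
  exact .comp .refl (.comp .refl (.dr .refl (.e _)))
theorem phF (hD : IsStringent D) {A A' A'' B B' : M} (f : A ⟶ A') (f' : A' ⟶ A'') (g : B ⟶ B') :
    CEq (D.φ (f ≫ f') g).hom
      (vsq ((D.φ f g).hom ▷ D.R B' f') (Strict.assoc ..) (D.R B f ◁ (D.φ f' g).hom)) := by
  rw [hD.phi_comp_fst f f' g (by rw [hD.R_comp, Strict.assoc]) (Strict.assoc ..)
    (by rw [hD.R_comp, Strict.assoc])]
  refine .dl (.e _) ?_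
  exact .comp .refl (.comp .refl (.dr .refl (.e _)))

theorem ph_nat (hD : IsStringent D) {A A' B B' : M} {f f₂ : A ⟶ A'} {g g₂ : B ⟶ B'} (x : f ⟶ f₂)
    (y : g ⟶ g₂) :
    (D.L₂ A y ▷ D.R B' f ≫ D.L A g₂ ◁ D.R₂ B' x) ≫ (D.φ f₂ g₂).hom =
      (D.φ f g).hom ≫ (D.R₂ B x ▷ D.L A' g ≫ D.R B f₂ ◁ D.L₂ A' y) := by
  rw [Category.assoc, ← hD.phi_natural_fst, ← Category.assoc, ← hD.phi_natural_snd,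
    Category.assoc, whisker_exchange]

end stringent

/-- If `(M, 1, ⊗, φ)` is a stringent monoidal 2-category, then defining
`Φ_{(f',g'),(f,g)} := id_{id_{A''} ⊗ g'} ∗ φ_{f',g} ∗ id_{f ⊗ id_B}` (the whiskering of
`φ_{f',g}` above by `id_{A''} ⊗ g'` and below by `f ⊗ id_B`, where
`f ⊗ g := (id_{A'} ⊗ g) ∘ (f ⊗ id_B)`) makes `⊗` into a cubical pseudofunctor and makes
`(M, 1, ⊗, Φ)` a semistrict monoidal 2-category. -/
theorem stringent_toSemistrict
    {M : Type u} [Bicategory.{w, v} M] [Bicategory.Strict M]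
    (D : StringentData M) (hD : IsStringent D)
    (e₁ : ∀ {A A' A'' B B' B'' : M} (f : A ⟶ A') (f' : A' ⟶ A'') (g : B ⟶ B') (g' : B' ⟶ B''),
      (D.R B f ≫ D.L A' g) ≫ (D.R B' f' ≫ D.L A'' g')
        = D.R B f ≫ ((D.L A' g ≫ D.R B' f') ≫ D.L A'' g'))
    (e₂ : ∀ {A A' A'' B B' B'' : M} (f : A ⟶ A') (f' : A' ⟶ A'') (g : B ⟶ B') (g' : B' ⟶ B''),
      D.R B f ≫ ((D.R B f' ≫ D.L A'' g) ≫ D.L A'' g')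
        = D.R B (f ≫ f') ≫ D.L A'' (g ≫ g')) :
    IsSemistrict
      { one := D.one
        t := D.t
        tHom := fun {_ A' B _} f g => D.R B f ≫ D.L A' g
        tCell := fun {_ A' B _} {_ f₂ _ _} α β =>
          (D.R₂ B α ▷ D.L A' _) ≫ (D.R B f₂ ◁ D.L₂ A' β)
        Φ := fun {A A' A'' B B' B''} f f' g g' =>
          eqToIso (e₁ f f' g g')
            ≪≫ whiskerLeftIso (D.R B f) (whiskerRightIso (D.φ f' g) (D.L A'' g'))
            ≪≫ eqToIso (e₂ f f' g g') } := by
  have cfe : ∀ {A A' B B' B'' : M} (f : A ⟶ A') (g : B ⟶ B') (g' : B' ⟶ B''),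
      (D.R B f ≫ D.L A' g) ≫ (D.R B' (𝟙 A') ≫ D.L A' g') =
        D.R B (f ≫ 𝟙 A') ≫ D.L A' (g ≫ g') := by
    intros
    simp [hD.R_id, hD.L_comp, Strict.id_comp, Strict.comp_id, Strict.assoc]
  have cse : ∀ {A A' A'' B B'' : M} (f : A ⟶ A') (f' : A' ⟶ A'') (g' : B ⟶ B''),
      (D.R B f ≫ D.L A' (𝟙 B)) ≫ (D.R B f' ≫ D.L A'' g') =
        D.R B (f ≫ f') ≫ D.L A'' (𝟙 B ≫ g') := by
    intros
    simp [hD.L_id, hD.R_comp, Strict.id_comp, Strict.comp_id, Strict.assoc]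
  constructor
  case tHom_id =>
    intro A B
    simp [hD.R_id, hD.L_id, Strict.id_comp]
  case tCell_id =>
    intros
    simp [hD.R₂_id, hD.L₂_id]
  case tCell_comp =>
    intros
    simp only [hD.R₂_comp, hD.L₂_comp, comp_whiskerRight, whiskerLeft_comp, Category.assoc]
    rw [whisker_exchange_assoc]
  case Φ_natural =>
    intro A A' A'' B B' B'' f f₂ f' f₂' g g₂ g' g₂' x x' y y'
    have H := abs_nat (D.R₂ B x) (D.L₂ A' y) (D.R₂ B' x') (D.L₂ A'' y') (D.R₂ B x') (D.L₂ A'' y)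
      (D.φ f' g).hom (D.φ f₂' g₂).hom (ph_nat hD x' y)
    refine CEq.eq (.trans ?_ ((CEq.of_eq H).trans ?_))
    · refine .comp .refl ((PhiC ..).trans (CEq.symm ?_))
      exact .dl (.comp (.ah ..) (.wl _ (.ai ..))) (.dr .refl (.comp (.wl _ (.ah ..)) (.ai ..)))
    · refine .comp (.trans ?_ (PhiC ..).symm)
        (.comp (.wr (RcC hD _ (Rwr hD ..) (Rwl hD ..)).symm (Lco hD ..).symm)
          (.wl (Rco hD ..).symm (LcC hD _ (Lwr hD ..) (Lwl hD ..)).symm))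
      exact .dl (.comp (.ah ..) (.wl _ (.ai ..))) (.dr .refl (.comp (.wl _ (.ah ..)) (.ai ..)))
  case Φ_coherence =>
    intro A A' A'' A''' B B' B'' B''' f f' f'' g g' g'' E₀ E₁
    refine CEq.eq ?_
    have h1 := (CEq.wl (f := D.R B f ≫ D.L A' g) .refl
      (PhiC (D.φ f'' g') (e₁ f' f'' g' g'') (e₂ f' f'' g' g''))).trans
      ((CEq.wl2 _ _ _).trans (w2 _ _ _ _ _))
    have h2 := (PhiC (D.φ (f' ≫ f'') g) (e₁ f (f' ≫ f'') g (g' ≫ g'')) (e₂ ..)).trans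
      ((CEq.wl .refl (.wr (phF hD f' f'' g) (Lco hD _ g' g''))).trans
        ((w3 ..).trans (CEq.sqc (w1 ..) (.wl .refl (CEq.wm ..)))))
    have h3 := (CEq.wr (f := D.R B'' f'' ≫ D.L A''' g'')
      (PhiC (D.φ f' g) (e₁ f f' g g') (e₂ f f' g g')) .refl).trans
      ((CEq.wm _ _ _).trans (w1 ..))
    have h4 := (PhiC (D.φ f'' (g ≫ g')) (e₁ (f ≫ f') f'' (g ≫ g') g'') (e₂ ..)).trans
      ((CEq.wl (Rco hD _ f f') (.wr (phS hD f'' g g') .refl)).trans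
        ((CEq.wl2 ..).trans ((CEq.wl .refl (w3 ..)).trans ((CEq.wl_sq ..).trans
          (CEq.sqc ((CEq.wl .refl (CEq.wl .refl (CEq.wm ..))).trans (w2 ..))
            (CEq.wl .refl (CEq.wl .refl (CEq.wr2 ..).symm)))))))
    refine CEq.dl (.e _) ((CEq.toSq h1 (.dr h2 (.e _))).trans (.trans ?_ (CEq.toSq h3 h4).symm))
    exact glue (exch ..) _ _ _ _
  case cubical_fst_eq => exact cfe
  case cubical_fst =>
    intro A A' B B' B'' f g g'
    refine CEq.eq ((PhiC ..).trans (IsE.ceq2 (.wl _ (.wr _ ?_)) (.e _) (.of_eq (e₁ ..).symm)))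
    rw [hD.phi_id_left A' g (by simp [hD.R_id])]
    exact .e _
  case cubical_snd_eq => exact cse
  case cubical_snd =>
    intro A A' A'' B B'' f f' g'
    refine CEq.eq ((PhiC ..).trans (IsE.ceq2 (.wl _ (.wr _ ?_)) (.e _) (.of_eq (e₁ ..).symm)))
    rw [hD.phi_id_right f' B (by simp [hD.L_id])]
    exact .e _
  case t_assoc => exact hD.t_assoc
  case t_one_left => exact hD.t_one_left
  case t_one_right => exact hD.t_one_right
  case tHom_assoc =>
    intro A A' B B' C C' f g h
    refine OEq.heq (OEq.trans (.comp ((Rco hD ..).trans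
      ((RRo hD ..).symm.comp (LRo hD ..).symm)) (LLo hD ..))
      ((OEq.assoc ..).trans (.comp .refl (Lco hD ..).symm)))
  case tHom_one_left =>
    intro B B' g
    simp only [hD.R_id, Strict.id_comp]
    exact hD.L_one g
  case tHom_one_right =>
    intro B B' g
    simp only [hD.L_id, Strict.comp_id]
    exact hD.R_one g
  case tCell_assoc =>
    intro A A' B B' C C' f f' g g' h h' x y z
    refine CEq.heq (CEq.trans ?_ ((abs_tri (D.R₂ (D.t B C) x) (D.L₂ A' (D.R₂ C y))
      (D.L₂ A' (D.L₂ B' z))).trans ?_))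
    · refine .comp (.wr ?_ (LLo hD ..))
        (.wl ((Rco hD ..).trans ((RRo hD ..).symm.comp (LRo hD ..).symm)) (LLc hD ..))
      exact (RcC hD _ (Rwr hD ..) (Rwl hD ..)).trans
        (.comp (.wr (RRc hD ..).symm (LRo hD ..).symm) (.wl (RRo hD ..).symm (LRc hD ..).symm))
    · exact .comp (.wr .refl (Lco hD ..).symm)
        (.wl .refl (LcC hD _ (Lwr hD ..) (Lwl hD ..)).symm)
  case tCell_one_left =>
    intro B B' g g' y
    refine CEq.heq (CEq.dl (.wr _ ?_) ((CEq.wl (.of_eq (hD.R_id ..)) .refl).trans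
      ((CEq.idl _).trans (L1c hD y))))
    rw [hD.R₂_id]
    exact .id _
  case tCell_one_right =>
    intro B B' g g' y
    refine CEq.heq (CEq.dr ((CEq.wr .refl (.of_eq (hD.L_id ..))).trans
      ((CEq.idr _).trans (R1c hD y))) (.wl _ ?_))
    rw [hD.L₂_id]
    exact .id _
  case Φ_assoc_compat =>
    intro A A' A'' B B' B'' C C' C'' f f' g g' h h'
    refine CEq.heq ?_
    have a1 := (phF hD (D.R B' f') (D.L A'' g') h).trans
      (CEq.sqc (.wr (phM hD ..) (LRo hD ..).symm) (.wl (RRo hD ..).symm (phL hD ..)))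
    have c1 := (PhiC (D.φ (D.R B' f' ≫ D.L A'' g') h)
      (e₁ (D.R B f ≫ D.L A' g) (D.R B' f' ≫ D.L A'' g') h h') (e₂ ..)).trans
      ((CEq.wl ((Rco hD ..).trans ((RRo hD ..).symm.comp (LRo hD ..).symm))
        (.wr a1 (LLo hD ..))).trans
        ((CEq.wl2 ..).trans ((CEq.wl .refl (w3 ..)).trans ((CEq.wl_sq ..).trans
          (CEq.sqc .refl ((CEq.wl .refl (CEq.wl .refl (CEq.wm ..))).trans (w2 ..)))))))
    have b2 := (CR D C (PhiC (D.φ f' g) (e₁ f f' g g') (e₂ f f' g g'))).trans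
      ((Rwl hD ..).trans ((CEq.wl .refl (Rwr hD ..)).trans
        (.wl (RRo hD ..).symm (.wr (phR hD ..).symm (LRo hD ..).symm))))
    have c2 := (CEq.wr b2 ((LLo hD A'' B'' (h ≫ h')).trans
      ((OL D rfl (Lco hD ..)).trans (Lco hD ..)))).trans ((CEq.wm ..).trans ((w1 ..).trans
        (CEq.wl .refl (.wr (.wr .refl (Lco hD ..).symm) .refl))))
    have d1 := (PhiC (D.φ f' (D.R C g ≫ D.L B' h))
      (e₁ f f' (D.R C g ≫ D.L B' h) (D.R C' g' ≫ D.L B'' h')) (e₂ ..)).trans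
      ((CEq.wl .refl (.wr (phS hD ..) (Lco hD ..))).trans
        ((w3 ..).trans (CEq.sqc (CEq.wl .refl ((CEq.wm ..).trans (.wl .refl (CEq.wr2 ..))))
          ((w1 ..).trans (CEq.wl .refl (.wr (.wr .refl (Lco hD ..).symm) .refl))))))
    have b3 := (CL D A'' (PhiC (D.φ g' h) (e₁ g g' h h') (e₂ g g' h h'))).trans
      ((Lwl hD ..).trans (CEq.wl .refl (Lwr hD ..)))
    have d2 := (CEq.wl (Rco hD (D.t B C) f f') b3).trans ((CEq.wl2 ..).trans (w2 ..))
    refine (CEq.toSq c1 (.dr c2 (.wl _ ?_))).trans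
      (.trans ?_ (CEq.toSq d1 (.dl (.wr _ ?_) d2)).symm)
    · rw [hD.L₂_id]; exact .id _
    · refine (CEq.sqa ..).symm.trans (.trans (.sqc .refl ?_) (CEq.sqa ..))
      exact (CEq.sq_rfl ..).trans ((CEq.of_eq (exch ..)).trans (CEq.sq_rfl _ rfl _).symm)
    · rw [hD.R₂_id]; exact .id _
end

section
/- The two constructions between semistrict and stringent monoidal 2-categories are inverse to each other on-the-nose: restricting a semistrict structure Φ to its underlying interchangor φ and then extending φ by the formula Φ'_{(f',g'),(f,g)} := id_{id ⊗ g'} ∗ φ_{f',g} ∗ id_{f ⊗ id} recovers Φ' = Φ exactly, and conversely extending a stringent interchangor φ to Φ and then restricting to Φ_{(f,id),(id,g)} recovers φ exactly. -/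
open CategoryTheory Bicategory

universe w v u

namespace SSAux

variable {M : Type u} [Bicategory.{w, v} M]

theorem wl_congr {a b c : M} {f f' : a ⟶ b} (hf : f = f') {g h g' h' : b ⟶ c} (hg : g = g')
    (hh : h = h') {η : g ⟶ h} {η' : g' ⟶ h'} (e : HEq η η') : HEq (f ◁ η) (f' ◁ η') := by
  subst hf hg hh; cases e; rfl

theorem wr_congr {a b c : M} {f f' : b ⟶ c} (hf : f = f') {g h g' h' : a ⟶ b} (hg : g = g')
    (hh : h = h') {η : g ⟶ h} {η' : g' ⟶ h'} (e : HEq η η') : HEq (η ▷ f) (η' ▷ f') := by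
  subst hf hg hh; cases e; rfl

theorem heq_of_sandwich {a b : M} {f g h k : a ⟶ b} (p : f = g) (q : h = k) (η : g ⟶ h) :
    HEq (eqToHom p ≫ η ≫ eqToHom q) η := by
  subst p q; simp

theorem comp_eqToHom_heq' {a b : M} {f g h : a ⟶ b} (η : f ⟶ g) (q : g = h) (θ : g ⟶ h)
    (e : θ = eqToHom q) : HEq (η ≫ θ) η := by
  subst e; subst q; simp

theorem eqToHom_comp_heq' {a b : M} {f g h : a ⟶ b} (q : f = g) (θ : f ⟶ g)
    (e : θ = eqToHom q) (η : g ⟶ h) : HEq (θ ≫ η) η := by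
  subst e; subst q; simp

theorem wl_eqToHom {a b c : M} (f : a ⟶ b) {g h : b ⟶ c} (p : g = h) :
    f ◁ eqToHom p = eqToHom (congrArg (fun x => f ≫ x) p) := by
  subst p; simp

theorem wr_eqToHom {a b c : M} (f : b ⟶ c) {g h : a ⟶ b} (p : g = h) :
    eqToHom p ▷ f = eqToHom (congrArg (fun x => x ≫ f) p) := by
  subst p; simp

variable [Bicategory.Strict M]

theorem wl_id {a b : M} {f g : a ⟶ b} (η : f ⟶ g) : HEq (𝟙 a ◁ η) η := by
  rw [id_whiskerLeft, Strict.leftUnitor_eqToIso, Strict.leftUnitor_eqToIso]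
  exact heq_of_sandwich (Strict.id_comp f) (Strict.id_comp g).symm η

theorem wr_id {a b : M} {f g : a ⟶ b} (η : f ⟶ g) : HEq (η ▷ 𝟙 b) η := by
  rw [whiskerRight_id, Strict.rightUnitor_eqToIso, Strict.rightUnitor_eqToIso]
  exact heq_of_sandwich (Strict.comp_id f) (Strict.comp_id g).symm η

theorem w_assoc {a b c d : M} (f : a ⟶ b) {g h : b ⟶ c} (η : g ⟶ h) (k : c ⟶ d) :
    HEq ((f ◁ η) ▷ k) (f ◁ η ▷ k) := by
  rw [whisker_assoc, Strict.associator_eqToIso, Strict.associator_eqToIso]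
  exact heq_of_sandwich (Strict.assoc f g k) (Strict.assoc f h k).symm _

theorem Φ_congr (D : SemistrictData M) {A A' A'' B B' B'' : M} {f k : A ⟶ A'} {f' k' : A' ⟶ A''}
    {g l : B ⟶ B'} {g' l' : B' ⟶ B''} (h₁ : f = k) (h₂ : f' = k') (h₃ : g = l) (h₄ : g' = l') :
    HEq (D.Φ f f' g g').hom (D.Φ k k' l l').hom := by
  subst h₁ h₂ h₃ h₄; rfl

/-- `Φ_{(f,g),(f',g')}` is `Φ_{(1,g),(f',g')}` whiskered with `f ⊗ 1`. -/
theorem step1 {D : SemistrictData M} (hD : IsSemistrict D) {A A' A'' B B' B'' : M}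
    (f : A ⟶ A') (f' : A' ⟶ A'') (g : B ⟶ B') (g' : B' ⟶ B'') :
    HEq (D.Φ f f' g g').hom (D.tHom f (𝟙 B) ◁ (D.Φ (𝟙 A') f' g g').hom) := by
  have h := hD.Φ_coherence f (𝟙 A') f' (𝟙 B) g g' (Strict.assoc _ _ _)
    (by simp only [Strict.assoc])
  rw [hD.cubical_fst, hD.cubical_snd, wr_eqToHom, eqToHom_trans] at h
  have h1 := eqToHom_comp_heq'
    (congrArg (fun x => x ≫ D.tHom f' g') (hD.cubical_fst_eq f (𝟙 B) g)) _ rfl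
    (D.Φ (f ≫ 𝟙 A') f' (𝟙 B ≫ g) g').hom
  refine (Φ_congr D (Strict.comp_id f).symm rfl (Strict.id_comp g).symm rfl).trans ?_
  refine h1.symm.trans ?_
  refine (heq_of_eq h.symm).trans ?_
  exact heq_of_sandwich _ _ _

/-- `Φ_{(1,g),(f',g')}` is `Φ_{(1,g),(f',1)}` whiskered with `1 ⊗ g'`. -/
theorem step2 {D : SemistrictData M} (hD : IsSemistrict D) {A' A'' B B' B'' : M}
    (f' : A' ⟶ A'') (g : B ⟶ B') (g' : B' ⟶ B'') :
    HEq (D.Φ (𝟙 A') f' g g').hom ((D.Φ (𝟙 A') f' g (𝟙 B')).hom ▷ D.tHom (𝟙 A'') g') := by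
  have h := hD.Φ_coherence (𝟙 A') f' (𝟙 A'') g (𝟙 B') g' (Strict.assoc _ _ _)
    (by simp only [Strict.assoc])
  rw [hD.cubical_fst, hD.cubical_fst, wl_eqToHom] at h
  have h2 := comp_eqToHom_heq' ((D.Φ (𝟙 A') f' g (𝟙 B')).hom ▷ D.tHom (𝟙 A'') g')
    (hD.cubical_fst_eq (𝟙 A' ≫ f') (g ≫ 𝟙 B') g') _ rfl
  refine HEq.trans ?_ ((heq_of_eq h).trans h2)
  rw [← Category.assoc, eqToHom_trans]
  refine HEq.trans ?_ (heq_of_sandwich _ _ _).symm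
  exact Φ_congr D rfl (Strict.comp_id f').symm rfl (Strict.id_comp g').symm

end SSAux

/-- The two constructions between semistrict and stringent monoidal
2-categories are inverse to each other on-the-nose: restricting a semistrict structure `Φ` to
its underlying interchangor `φ_{f,g} := Φ_{(f,id),(id,g)}` and then extending by the formula
`Φ'_{(f',g'),(f,g)} := id_{id ⊗ g'} ∗ φ_{f',g} ∗ id_{f ⊗ id}` recovers `Φ' = Φ` exactly;
and conversely extending a stringent interchangor `φ` to `Φ` by that formula and then
restricting to `Φ_{(f,id),(id,g)}` recovers `φ` exactly. -/
theorem semistrict_stringent_inverse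
    {M : Type u} [Bicategory.{w, v} M] [Bicategory.Strict M]
    {N : Type u} [Bicategory.{w, v} N] [Bicategory.Strict N]
    (D : SemistrictData M) (hD : IsSemistrict D)
    (E : StringentData N) (hE : IsStringent E) :
    -- (a) restrict then extend recovers `Φ` on-the-nose
    (∀ {A A' A'' B B' B'' : M} (f : A ⟶ A') (f' : A' ⟶ A'') (g : B ⟶ B') (g' : B' ⟶ B'')
      (e₁ : D.tHom f g ≫ D.tHom f' g'
              = (D.tHom f (𝟙 B) ≫ (D.tHom (𝟙 A') g ≫ D.tHom f' (𝟙 B'))) ≫ D.tHom (𝟙 A'') g')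
      (e₂ : (D.tHom f (𝟙 B) ≫ D.tHom (𝟙 A' ≫ f') (g ≫ 𝟙 B')) ≫ D.tHom (𝟙 A'') g'
              = D.tHom (f ≫ f') (g ≫ g')),
      (D.Φ f f' g g').hom
        = eqToHom e₁
            ≫ ((D.tHom f (𝟙 B) ◁ (D.Φ (𝟙 A') f' g (𝟙 B')).hom) ▷ D.tHom (𝟙 A'') g')
            ≫ eqToHom e₂)
    ∧
    -- (b) extend then restrict recovers `φ` on-the-nose
    (∀ {A A' B B' : N} (f : A ⟶ A') (g : B ⟶ B')
      (E₁ : E.L A g ≫ E.R B' f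
              = E.R B (𝟙 A) ≫ ((E.L A g ≫ E.R B' f) ≫ E.L A' (𝟙 B')))
      (E₂ : E.R B (𝟙 A) ≫ ((E.R B f ≫ E.L A' g) ≫ E.L A' (𝟙 B'))
              = E.R B f ≫ E.L A' g),
      eqToHom E₁ ≫ (E.R B (𝟙 A) ◁ ((E.φ f g).hom ▷ E.L A' (𝟙 B'))) ≫ eqToHom E₂
        = (E.φ f g).hom) := by
  refine ⟨?_, ?_⟩
  · intro A A' A'' B B' B'' f f' g g' e₁ e₂
    apply eq_of_heq
    refine HEq.trans ?_ (SSAux.heq_of_sandwich e₁ e₂ _).symm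
    refine (SSAux.step1 hD f f' g g').trans ?_
    refine HEq.trans ?_ (SSAux.w_assoc _ _ _).symm
    refine SSAux.wl_congr rfl ?_ ?_ (SSAux.step2 hD f' g g')
    · have := hD.cubical_fst_eq f' (𝟙 B') g'
      rw [Strict.comp_id, Strict.id_comp] at this
      rw [Strict.assoc, this]
    · have := hD.cubical_fst_eq (𝟙 A' ≫ f') (g ≫ 𝟙 B') g'
      rw [this]
      simp only [Strict.comp_id]
  · intro A A' B B' f g E₁ E₂
    apply eq_of_heq
    refine (SSAux.heq_of_sandwich E₁ E₂ _).trans ?_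
    refine (SSAux.wl_congr (hE.R_id B A) rfl rfl HEq.rfl).trans ?_
    refine (SSAux.wl_id _).trans ?_
    refine (SSAux.wr_congr (hE.L_id A' B') rfl rfl HEq.rfl).trans ?_
    exact SSAux.wr_id _
end

section
/- If (M, 1, ⊗, Φ, β) is a quasistrict symmetric monoidal 2-category, then M together with the underlying interchangor φ_{f,g} := Φ_{(f,id),(id,g)} and the braiding 1-morphisms β_{A,B} is a stringent symmetric monoidal 2-category; that is, the following hold on the nose: (i) β_{A,B} ∘ β_{B,A} = id; (ii) β_{A⊗B,C} = (β_{A,C} ⊗ id_B) ∘ (id_A ⊗ β_{B,C}), and the analogous equation for β_{A,B⊗C}; (iii) β_{A',B} ∘ (f ⊗ id_B) = (id_B ⊗ f) ∘ β_{A,B} for every f : A → A', and similarly in the second variable; (iv) φ_{f,β_{B,C}} = id and φ_{β_{A,B},g} = id. -/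
open CategoryTheory Bicategory

universe w v u

/-- The data underlying a quasistrict symmetric monoidal 2-category: semistrict monoidal
data together with braiding 1-morphisms `β_{A,B} : A ⊗ B ⟶ B ⊗ A` and the naturality
2-isomorphisms `β_{f,g}` of the braiding transformation. -/
structure QuasistrictData (M : Type u) [Bicategory.{w, v} M] [Bicategory.Strict M] extends
    SemistrictData M where
  β : ∀ A B : M, t A B ⟶ t B A
  βCell : ∀ {A A' B B' : M} (f : A ⟶ A') (g : B ⟶ B'),
    tHom f g ≫ β A' B' ⟶ β A B ≫ tHom g f

/-- The axioms of a quasistrict symmetric monoidal 2-category (Schommer-Pries): the underlying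
monoidal bicategory is a Gray monoid, `β_{1,A}` and `β_{A,1}` are identities, and
(QS.1) the modifications `R`, `S` and the syllepsis `σ` are identities;
(QS.2) `β_{f,g}` is an identity whenever `f` or `g` is an identity 1-morphism;
(QS.3) `Φ_{(f',g'),(f,g)}` is an identity whenever `f'` or `g` is a braiding component. -/
structure IsQuasistrict {M : Type u} [Bicategory.{w, v} M] [Bicategory.Strict M]
    (Q : QuasistrictData M) : Prop where
  /- the underlying monoidal bicategory is a Gray monoid -/
  semistrict : IsSemistrict Q.toSemistrictData
  /- the braiding with the unit object is the identity -/
  β_one_left : ∀ (A : M) (e : Q.t Q.one A = Q.t A Q.one), Q.β Q.one A = eqToHom e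
  β_one_right : ∀ (A : M) (e : Q.t A Q.one = Q.t Q.one A), Q.β A Q.one = eqToHom e
  /- `β` is a transformation: naturality of `β_{f,g}` in 2-morphisms, and
  compatibility with the composition coherences `Φ` (the transformation coherence equation) -/
  βCell_natural : ∀ {A A' B B' : M} {f f₂ : A ⟶ A'} {g g₂ : B ⟶ B'}
    (η : f ⟶ f₂) (θ : g ⟶ g₂),
    (Q.tCell η θ ▷ Q.β A' B') ≫ Q.βCell f₂ g₂ = Q.βCell f g ≫ (Q.β A B ◁ Q.tCell θ η)
  β_coherence : ∀ {A A' A'' B B' B'' : M}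
    (f : A ⟶ A') (f' : A' ⟶ A'') (g : B ⟶ B') (g' : B' ⟶ B'')
    (E₁ : (Q.tHom f g ≫ Q.tHom f' g') ≫ Q.β A'' B''
            = Q.tHom f g ≫ (Q.tHom f' g' ≫ Q.β A'' B''))
    (E₂ : Q.tHom f g ≫ (Q.β A' B' ≫ Q.tHom g' f')
            = (Q.tHom f g ≫ Q.β A' B') ≫ Q.tHom g' f')
    (E₃ : (Q.β A B ≫ Q.tHom g f) ≫ Q.tHom g' f'
            = Q.β A B ≫ (Q.tHom g f ≫ Q.tHom g' f')),
    ((Q.Φ f f' g g').hom ▷ Q.β A'' B'') ≫ Q.βCell (f ≫ f') (g ≫ g')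
      = eqToHom E₁ ≫ (Q.tHom f g ◁ Q.βCell f' g') ≫ eqToHom E₂
          ≫ (Q.βCell f g ▷ Q.tHom g' f') ≫ eqToHom E₃ ≫ (Q.β A B ◁ (Q.Φ g g' f f').hom)
  /- (QS.1): the syllepsis `σ_{A,B} : id ⇒ β_{B,A} ∘ β_{A,B}` is the identity -/
  σ_identity : ∀ A B : M, Q.β A B ≫ Q.β B A = 𝟙 (Q.t A B)
  /- (QS.1): the modifications `R_{A,B|C}` and `S_{A|B,C}` are identities -/
  R_identity : ∀ (A B C : M)
    (e₁ : Q.t (Q.t A B) C = Q.t A (Q.t B C))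
    (e₂ : Q.t A (Q.t C B) = Q.t (Q.t A C) B)
    (e₃ : Q.t (Q.t C A) B = Q.t C (Q.t A B)),
    Q.β (Q.t A B) C
      = eqToHom e₁ ≫ Q.tHom (𝟙 A) (Q.β B C) ≫ eqToHom e₂
          ≫ Q.tHom (Q.β A C) (𝟙 B) ≫ eqToHom e₃
  S_identity : ∀ (A B C : M)
    (e₁ : Q.t A (Q.t B C) = Q.t (Q.t A B) C)
    (e₂ : Q.t (Q.t B A) C = Q.t B (Q.t A C))
    (e₃ : Q.t B (Q.t C A) = Q.t (Q.t B C) A),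
    Q.β A (Q.t B C)
      = eqToHom e₁ ≫ Q.tHom (Q.β A B) (𝟙 C) ≫ eqToHom e₂
          ≫ Q.tHom (𝟙 B) (Q.β A C) ≫ eqToHom e₃
  /- (QS.2): `β_{f,g}` is the identity whenever `f` or `g` is an identity 1-morphism -/
  qs2_snd_eq : ∀ {A A' : M} (f : A ⟶ A') (B : M),
    Q.tHom f (𝟙 B) ≫ Q.β A' B = Q.β A B ≫ Q.tHom (𝟙 B) f
  qs2_snd : ∀ {A A' : M} (f : A ⟶ A') (B : M),
    Q.βCell f (𝟙 B) = eqToHom (qs2_snd_eq f B)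
  qs2_fst_eq : ∀ (A : M) {B B' : M} (g : B ⟶ B'),
    Q.tHom (𝟙 A) g ≫ Q.β A B' = Q.β A B ≫ Q.tHom g (𝟙 A)
  qs2_fst : ∀ (A : M) {B B' : M} (g : B ⟶ B'),
    Q.βCell (𝟙 A) g = eqToHom (qs2_fst_eq A g)
  /- (QS.3): `Φ_{(f',g'),(f,g)}` is the identity whenever `f'` or `g` is a braiding component -/
  qs3_fst_eq : ∀ {A B B' B'' X Y : M} (f : A ⟶ Q.t X Y) (g : B ⟶ B') (g' : B' ⟶ B''),
    Q.tHom f g ≫ Q.tHom (Q.β X Y) g' = Q.tHom (f ≫ Q.β X Y) (g ≫ g')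
  qs3_fst : ∀ {A B B' B'' X Y : M} (f : A ⟶ Q.t X Y) (g : B ⟶ B') (g' : B' ⟶ B''),
    (Q.Φ f (Q.β X Y) g g').hom = eqToHom (qs3_fst_eq f g g')
  qs3_snd_eq : ∀ {A A' A'' X Y B'' : M} (f : A ⟶ A') (f' : A' ⟶ A'') (g' : Q.t Y X ⟶ B''),
    Q.tHom f (Q.β X Y) ≫ Q.tHom f' g' = Q.tHom (f ≫ f') (Q.β X Y ≫ g')
  qs3_snd : ∀ {A A' A'' X Y B'' : M} (f : A ⟶ A') (f' : A' ⟶ A'') (g' : Q.t Y X ⟶ B''),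
    (Q.Φ f f' (Q.β X Y) g').hom = eqToHom (qs3_snd_eq f f' g')
/-- The data underlying a stringent symmetric monoidal 2-category: stringent monoidal data
together with braiding 1-morphisms `β_{A,B} : A ⊗ B ⟶ B ⊗ A`. -/
structure StringentSymmetricData (M : Type u) [Bicategory.{w, v} M] [Bicategory.Strict M]
    extends StringentData M where
  β : ∀ A B : M, t A B ⟶ t B A

/-- The axioms of a stringent symmetric monoidal 2-category: the underlying stringent monoidal
axioms together with the on-the-nose axioms (i)–(iv) for the braiding. -/
structure IsStringentSymmetric {M : Type u} [Bicategory.{w, v} M] [Bicategory.Strict M]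
    (D : StringentSymmetricData M) : Prop where
  stringent : IsStringent D.toStringentData
  /- (i): `β_{A,B} ∘ β_{B,A} = id` -/
  braid_invol : ∀ A B : M, D.β A B ≫ D.β B A = 𝟙 (D.t A B)
  /- (ii): `β_{A⊗B,C} = (β_{A,C} ⊗ id_B) ∘ (id_A ⊗ β_{B,C})`, and the analogous equation
  for `β_{A,B⊗C}` -/
  braid_tensor_fst : ∀ (A B C : M)
    (e₁ : D.t (D.t A B) C = D.t A (D.t B C))
    (e₂ : D.t A (D.t C B) = D.t (D.t A C) B)
    (e₃ : D.t (D.t C A) B = D.t C (D.t A B)),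
    D.β (D.t A B) C
      = eqToHom e₁ ≫ D.L A (D.β B C) ≫ eqToHom e₂ ≫ D.R B (D.β A C) ≫ eqToHom e₃
  braid_tensor_snd : ∀ (A B C : M)
    (e₁ : D.t A (D.t B C) = D.t (D.t A B) C)
    (e₂ : D.t (D.t B A) C = D.t B (D.t A C))
    (e₃ : D.t B (D.t C A) = D.t (D.t B C) A),
    D.β A (D.t B C)
      = eqToHom e₁ ≫ D.R C (D.β A B) ≫ eqToHom e₂ ≫ D.L B (D.β A C) ≫ eqToHom e₃
  /- (iii): on-the-nose naturality of `β` against `f ⊗ id` and `id ⊗ g` -/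
  braid_natural_fst : ∀ {A A' : M} (f : A ⟶ A') (B : M),
    D.R B f ≫ D.β A' B = D.β A B ≫ D.L B f
  braid_natural_snd : ∀ (A : M) {B B' : M} (g : B ⟶ B'),
    D.L A g ≫ D.β A B' = D.β A B ≫ D.R A g
  /- (iv): the interchangor is trivial against braiding components -/
  phi_braid_snd_eq : ∀ {A A' : M} (f : A ⟶ A') (B C : M),
    D.L A (D.β B C) ≫ D.R (D.t C B) f = D.R (D.t B C) f ≫ D.L A' (D.β B C)
  phi_braid_snd : ∀ {A A' : M} (f : A ⟶ A') (B C : M),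
    (D.φ f (D.β B C)).hom = eqToHom (phi_braid_snd_eq f B C)
  phi_braid_fst_eq : ∀ (A B : M) {C C' : M} (g : C ⟶ C'),
    D.L (D.t A B) g ≫ D.R C' (D.β A B) = D.R C (D.β A B) ≫ D.L (D.t B A) g
  phi_braid_fst : ∀ (A B : M) {C C' : M} (g : C ⟶ C'),
    (D.φ (D.β A B) g).hom = eqToHom (phi_braid_fst_eq A B g)
set_option linter.unusedSimpArgs false

namespace QSaux

section
variable {M : Type u} [Bicategory.{w, v} M] [Bicategory.Strict M]

theorem strip {C : Type u} [Category.{v} C] {W X Y Z : C} {a : W = X} {b : Y = Z} {x : X ⟶ Y}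
    {y : W ⟶ Z} (k : eqToHom a ≫ x ≫ eqToHom b = y) :
    x = eqToHom a.symm ≫ y ≫ eqToHom b.symm := by
  subst a b k; simp

theorem heq_l {C : Type u} [Category.{v} C] {X Y Z : C} {β : Type v} (a : X = Y) (f : Y ⟶ Z)
    (y : β) : (eqToHom a ≫ f ≍ y) ↔ (f ≍ y) := by
  subst a; simp

theorem heq_r {C : Type u} [Category.{v} C] {X Y Z : C} {β : Type v} (a : Y = Z) (f : X ⟶ Y)
    (y : β) : (f ≫ eqToHom a ≍ y) ↔ (f ≍ y) := by
  subst a; simp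

theorem heq_l' {C : Type u} [Category.{v} C] {X Y Z : C} {β : Type v} (a : X = Y) (f : Y ⟶ Z)
    (y : β) : (y ≍ eqToHom a ≫ f) ↔ (y ≍ f) := by
  subst a; simp

theorem heq_r' {C : Type u} [Category.{v} C] {X Y Z : C} {β : Type v} (a : Y = Z) (f : X ⟶ Y)
    (y : β) : (y ≍ f ≫ eqToHom a) ↔ (y ≍ f) := by
  subst a; simp

theorem wl_congr {a b c : M} {f f' : a ⟶ b} (hf : f = f') {g g' : b ⟶ c} (η : g ⟶ g') :
    f ◁ η = eqToHom (by rw [hf]) ≫ (f' ◁ η) ≫ eqToHom (by rw [hf]) := by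
  subst hf; simp

theorem wr_congr {a b c : M} {f f' : a ⟶ b} (η : f ⟶ f') {g g' : b ⟶ c} (hg : g = g') :
    η ▷ g = eqToHom (by rw [hg]) ≫ (η ▷ g') ≫ eqToHom (by rw [hg]) := by
  subst hg; simp

theorem id_wl {a b : M} {f g : a ⟶ b} (η : f ⟶ g) :
    𝟙 a ◁ η = eqToHom (Strict.id_comp f) ≫ η ≫ eqToHom (Strict.id_comp g).symm := by
  simp [Strict.leftUnitor_eqToIso]

theorem wr_id {a b : M} {f g : a ⟶ b} (η : f ⟶ g) :
    η ▷ 𝟙 b = eqToHom (Strict.comp_id f) ≫ η ≫ eqToHom (Strict.comp_id g).symm := by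
  simp [Strict.rightUnitor_eqToIso]

theorem Φ_congr (D : SemistrictData M) {A A' A'' B B' B'' : M}
    {f f₂ : A ⟶ A'} {f' f₂' : A' ⟶ A''} {g g₂ : B ⟶ B'} {g' g₂' : B' ⟶ B''}
    (h₁ : f = f₂) (h₂ : f' = f₂') (h₃ : g = g₂) (h₄ : g' = g₂') :
    (D.Φ f f' g g').hom = eqToHom (by rw [h₁, h₂, h₃, h₄]) ≫ (D.Φ f₂ f₂' g₂ g₂').hom ≫
      eqToHom (by rw [h₁, h₂, h₃, h₄]) := by
  subst h₁ h₂ h₃ h₄; simp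

theorem tCell_congr (D : SemistrictData M) {A A' B B' : M} {f f' f₂ f₂' : A ⟶ A'}
    {g g' g₂ g₂' : B ⟶ B'} {η : f ⟶ f'} {η₂ : f₂ ⟶ f₂'} {θ : g ⟶ g'} {θ₂ : g₂ ⟶ g₂'}
    (h₁ : f = f₂) (h₂ : f' = f₂') (h₃ : g = g₂) (h₄ : g' = g₂')
    (hη : η = eqToHom h₁ ≫ η₂ ≫ eqToHom h₂.symm)
    (hθ : θ = eqToHom h₃ ≫ θ₂ ≫ eqToHom h₄.symm) :
    D.tCell η θ = eqToHom (by rw [h₁, h₃]) ≫ D.tCell η₂ θ₂ ≫ eqToHom (by rw [h₂, h₄]) := by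
  subst h₁ h₂ h₃ h₄ hη hθ; simp

theorem tCell_id_left (D : SemistrictData M) {A A' B B' : M} {f f' : A ⟶ A'} (p : f = f')
    {g g' : B ⟶ B'} (η : g ⟶ g') :
    D.tCell (𝟙 f) η = eqToHom (by rw [p]) ≫ D.tCell (𝟙 f') η ≫ eqToHom (by rw [p]) := by
  subst p; simp

theorem tCell_id_right (D : SemistrictData M) {A A' B B' : M} {f f' : A ⟶ A'} (p : f = f')
    {g g' : B ⟶ B'} (η : g ⟶ g') :
    D.tCell η (𝟙 f) = eqToHom (by rw [p]) ≫ D.tCell η (𝟙 f') ≫ eqToHom (by rw [p]) := by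
  subst p; simp

theorem tCell_conj_right (D : SemistrictData M) {A A' B B' : M} (f : A ⟶ A')
    {g₀ g g' g₁ : B ⟶ B'} (p : g₀ = g) (η : g ⟶ g') (q : g' = g₁) :
    D.tCell (𝟙 f) (eqToHom p ≫ η ≫ eqToHom q) =
      eqToHom (by rw [p]) ≫ D.tCell (𝟙 f) η ≫ eqToHom (by rw [q]) := by
  subst p q; simp

theorem tCell_conj_left (D : SemistrictData M) {A A' B B' : M} (f : A ⟶ A')
    {g₀ g g' g₁ : B ⟶ B'} (p : g₀ = g) (η : g ⟶ g') (q : g' = g₁) :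
    D.tCell (eqToHom p ≫ η ≫ eqToHom q) (𝟙 f) =
      eqToHom (by rw [p]) ≫ D.tCell η (𝟙 f) ≫ eqToHom (by rw [q]) := by
  subst p q; simp

theorem tCell_comp_right (D : SemistrictData M) {A A' B B' : M} (f : A ⟶ A')
    {g g' g₁ : B ⟶ B'} (η : g ⟶ g') (q : g' = g₁) :
    D.tCell (𝟙 f) (η ≫ eqToHom q) = D.tCell (𝟙 f) η ≫ eqToHom (by rw [q]) := by
  subst q; simp

theorem tCell_comp_left (D : SemistrictData M) {A A' B B' : M} (f : A ⟶ A')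
    {g g' g₁ : B ⟶ B'} (η : g ⟶ g') (q : g' = g₁) :
    D.tCell (η ≫ eqToHom q) (𝟙 f) = D.tCell η (𝟙 f) ≫ eqToHom (by rw [q]) := by
  subst q; simp

variable {D : SemistrictData M} (h : IsSemistrict D)
include h

theorem tCell_eqToHom {A A' B B' : M} {f f' : A ⟶ A'} {g g' : B ⟶ B'} (p : f = f') (q : g = g') :
    D.tCell (eqToHom p) (eqToHom q) = eqToHom (by rw [p, q]) := by
  subst p q; simp [h.tCell_id]

theorem L_comp (A : M) {B B' B'' : M} (g : B ⟶ B') (g' : B' ⟶ B'') :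
    D.tHom (𝟙 A) (g ≫ g') = D.tHom (𝟙 A) g ≫ D.tHom (𝟙 A) g' := by
  rw [h.cubical_fst_eq, Strict.id_comp]

theorem R_comp (A : M) {B B' B'' : M} (g : B ⟶ B') (g' : B' ⟶ B'') :
    D.tHom (g ≫ g') (𝟙 A) = D.tHom g (𝟙 A) ≫ D.tHom g' (𝟙 A) := by
  rw [h.cubical_snd_eq, Strict.id_comp]

theorem RL {A A' B B' : M} (f : A ⟶ A') (g : B ⟶ B') :
    D.tHom f (𝟙 B) ≫ D.tHom (𝟙 A') g = D.tHom f g := by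
  rw [h.cubical_fst_eq, Strict.id_comp, Strict.comp_id]

/-- `Φ (1,f) (g,g')` in terms of the interchangor. -/
theorem Φ_right {A A' B B' B'' : M} (f : A ⟶ A') (g : B ⟶ B') (g' : B' ⟶ B'') :
    (D.Φ (𝟙 A) f g g').hom =
      eqToHom (by rw [← RL h f g', Strict.assoc]) ≫
      ((D.Φ (𝟙 A) f g (𝟙 B')).hom ▷ D.tHom (𝟙 A') g') ≫
      eqToHom (by rw [h.cubical_fst_eq]; simp only [Strict.comp_id]) := by
  have k := h.Φ_coherence (𝟙 A) f (𝟙 A') g (𝟙 B') g' (Strict.assoc _ _ _)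
    (by simp only [Strict.assoc])
  rw [h.cubical_fst, h.cubical_fst,
    Φ_congr D rfl (Strict.comp_id f) rfl (Strict.id_comp g')] at k
  simp only [whiskerLeft_eqToHom, Category.assoc, eqToHom_trans, eqToHom_trans_assoc] at k
  rw [strip k]
  simp

/-- `Φ (f,f') (g,1)` in terms of the interchangor. -/
theorem Φ_left {A A' A'' B B' : M} (f : A ⟶ A') (f' : A' ⟶ A'') (g : B ⟶ B') :
    (D.Φ f f' g (𝟙 B')).hom =
      eqToHom (by rw [← RL h f g, Strict.assoc]) ≫
      (D.tHom f (𝟙 B) ◁ (D.Φ (𝟙 A') f' g (𝟙 B')).hom) ≫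
      eqToHom (by rw [h.cubical_snd_eq]; simp only [Strict.id_comp]) := by
  have k := h.Φ_coherence f (𝟙 A') f' (𝟙 B) g (𝟙 B') (Strict.assoc _ _ _)
    (by simp only [Strict.assoc])
  rw [h.cubical_fst, h.cubical_snd,
    Φ_congr D (Strict.comp_id f) rfl (Strict.id_comp g) rfl] at k
  simp only [eqToHom_whiskerRight, Category.assoc, eqToHom_trans, eqToHom_trans_assoc] at k
  rw [strip k.symm]
  simp

theorem phi_comp_snd {A A' B B' B'' : M} (f : A ⟶ A') (g : B ⟶ B') (g' : B' ⟶ B'') :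
    (D.Φ (𝟙 A) f (g ≫ g') (𝟙 B'')).hom =
      eqToHom (by rw [L_comp h, Strict.assoc]) ≫
      (D.tHom (𝟙 A) g ◁ (D.Φ (𝟙 A) f g' (𝟙 B'')).hom) ≫
      eqToHom (by rw [Strict.id_comp, Strict.comp_id, ← RL h f g', Strict.assoc]) ≫
      ((D.Φ (𝟙 A) f g (𝟙 B')).hom ▷ D.tHom (𝟙 A') g') ≫
      eqToHom (by rw [h.cubical_fst_eq]; simp only [Strict.comp_id]) := by
  have k := h.Φ_coherence (𝟙 A) (𝟙 A) f g g' (𝟙 B'') (Strict.assoc _ _ _)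
    (by simp only [Strict.assoc])
  rw [h.cubical_fst, Φ_congr D (Strict.id_comp (𝟙 A)) rfl rfl rfl,
    Φ_congr D rfl (Strict.id_comp f) rfl (Strict.comp_id g'), Φ_right h f g g'] at k
  simp only [eqToHom_whiskerRight, Category.assoc, eqToHom_trans, eqToHom_trans_assoc] at k
  rw [strip k.symm]
  simp

theorem phi_comp_fst {A A' A'' B B' : M} (f : A ⟶ A') (f' : A' ⟶ A'') (g : B ⟶ B') :
    (D.Φ (𝟙 A) (f ≫ f') g (𝟙 B')).hom =
      eqToHom (by rw [R_comp h, Strict.assoc]) ≫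
      ((D.Φ (𝟙 A) f g (𝟙 B')).hom ▷ D.tHom f' (𝟙 B')) ≫
      eqToHom (by rw [Strict.id_comp, Strict.comp_id, ← RL h, Strict.assoc]) ≫
      (D.tHom f (𝟙 B) ◁ (D.Φ (𝟙 A') f' g (𝟙 B')).hom) ≫
      eqToHom (by rw [h.cubical_snd_eq]; simp only [Strict.id_comp]) := by
  have k := h.Φ_coherence (𝟙 A) f f' g (𝟙 B') (𝟙 B') (Strict.assoc _ _ _)
    (by simp only [Strict.assoc])
  rw [h.cubical_snd, Φ_congr D rfl rfl rfl (Strict.id_comp (𝟙 B')),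
    Φ_congr D (Strict.id_comp f) rfl (Strict.comp_id g) rfl, Φ_left h f f' g] at k
  simp only [whiskerLeft_eqToHom, Category.assoc, eqToHom_trans, eqToHom_trans_assoc] at k
  rw [strip k]
  simp

theorem tCell_R {A A' B B' : M} {f f' : A ⟶ A'} (α : f ⟶ f') (g : B ⟶ B') :
    D.tCell α (𝟙 g) = eqToHom (RL h f g).symm ≫ (D.tCell α (𝟙 (𝟙 B)) ▷ D.tHom (𝟙 A') g) ≫
      eqToHom (RL h f' g) := by
  have k := h.Φ_natural α (𝟙 (𝟙 A')) (𝟙 (𝟙 B)) (𝟙 g)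
  simp only [h.cubical_fst, h.tCell_id, id_whiskerRight, whiskerLeft_id, Category.comp_id, wr_id,
    tCell_id_right D (Strict.id_comp g), tCell_conj_left, Category.assoc, eqToHom_trans,
    eqToHom_trans_assoc] at k
  rw [strip k.symm]
  simp

theorem tCell_L {A A' B B' : M} (f : A ⟶ A') {g g' : B ⟶ B'} (α : g ⟶ g') :
    D.tCell (𝟙 f) α = eqToHom (RL h f g).symm ≫ (D.tHom f (𝟙 B) ◁ D.tCell (𝟙 (𝟙 A')) α) ≫
      eqToHom (RL h f g') := by
  have k := h.Φ_natural (𝟙 f) (𝟙 (𝟙 A')) (𝟙 (𝟙 B)) α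
  simp only [h.cubical_fst, h.tCell_id, id_whiskerRight, whiskerLeft_id, Category.comp_id, id_wl,
    Category.id_comp,
    tCell_id_left D (Strict.comp_id f), tCell_conj_right, Category.assoc, eqToHom_trans,
    eqToHom_trans_assoc] at k
  rw [strip k.symm]
  simp

end
end QSaux

/-- If `(M, 1, ⊗, Φ, β)` is a quasistrict symmetric monoidal 2-category,
then `M` together with the underlying interchangor `φ_{f,g} := Φ_{(f,id),(id,g)}` and the
braiding 1-morphisms `β_{A,B}` is a stringent symmetric monoidal 2-category. -/
theorem quasistrict_toStringentSymmetric
    {M : Type u} [Bicategory.{w, v} M] [Bicategory.Strict M]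
    (Q : QuasistrictData M) (hQ : IsQuasistrict Q)
    (e : ∀ {A A' B B' : M} (f : A ⟶ A') (g : B ⟶ B'),
      Q.tHom (𝟙 A ≫ f) (g ≫ 𝟙 B') = Q.tHom f (𝟙 B) ≫ Q.tHom (𝟙 A') g) :
    IsStringentSymmetric
      { one := Q.one
        t := Q.t
        L := fun A {_ _} g => Q.tHom (𝟙 A) g
        R := fun A {_ _} f => Q.tHom f (𝟙 A)
        L₂ := fun A {_ _} {_ _} η => Q.tCell (𝟙 (𝟙 A)) η
        R₂ := fun A {_ _} {_ _} η => Q.tCell η (𝟙 (𝟙 A))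
        φ := fun {A _ B B'} f g => Q.Φ (𝟙 A) f g (𝟙 B') ≪≫ eqToIso (e f g)
        β := Q.β } := by
  have h := hQ.semistrict
  constructor
  case stringent =>
    constructor
    case t_assoc => exact h.t_assoc
    case t_one_left => exact h.t_one_left
    case t_one_right => exact h.t_one_right
    case L_id => exact h.tHom_id
    case R_id => exact fun A B => h.tHom_id B A
    case L_comp => exact fun A {_ _ _} g g' => QSaux.L_comp h A g g'
    case R_comp => exact fun A {_ _ _} g g' => QSaux.R_comp h A g g'
    case L₂_id => exact fun A {_ _} g => h.tCell_id _ g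
    case R₂_id => exact fun A {_ _} g => h.tCell_id g _
    case L₂_comp =>
      intro A B B' g g' g'' η θ
      have := h.tCell_comp (𝟙 (𝟙 A)) (𝟙 (𝟙 A)) η θ
      rwa [Category.comp_id] at this
    case R₂_comp =>
      intro A B B' g g' g'' η θ
      have := h.tCell_comp η θ (𝟙 (𝟙 A)) (𝟙 (𝟙 A))
      rwa [Category.comp_id] at this
    case L₂_whiskerLeft =>
      intro A B B' B'' g l l' η e₁ e₂
      have k := h.Φ_natural (𝟙 (𝟙 A)) (𝟙 (𝟙 A)) (𝟙 g) η
      simp only [h.cubical_fst, h.tCell_id, id_whiskerRight, whiskerLeft_id,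
        Category.comp_id, Category.id_comp, QSaux.tCell_id_left Q.toSemistrictData (Strict.id_comp (𝟙 A)),
        Category.assoc, eqToHom_trans, eqToHom_trans_assoc] at k
      dsimp only
      rw [QSaux.strip k.symm]
      simp
    case L₂_whiskerRight =>
      intro A B B' B'' g g' η l e₁ e₂
      have k := h.Φ_natural (𝟙 (𝟙 A)) (𝟙 (𝟙 A)) η (𝟙 l)
      simp only [h.cubical_fst, h.tCell_id, id_whiskerRight, whiskerLeft_id,
        Category.comp_id, Category.id_comp, QSaux.tCell_id_left Q.toSemistrictData (Strict.id_comp (𝟙 A)),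
        Category.assoc, eqToHom_trans, eqToHom_trans_assoc] at k
      dsimp only
      rw [QSaux.strip k.symm]
      simp
    case R₂_whiskerLeft =>
      intro A B B' B'' g l l' η e₁ e₂
      have k := h.Φ_natural (𝟙 g) η (𝟙 (𝟙 A)) (𝟙 (𝟙 A))
      simp only [h.cubical_snd, h.tCell_id, id_whiskerRight, whiskerLeft_id,
        Category.comp_id, Category.id_comp, QSaux.tCell_id_right Q.toSemistrictData (Strict.id_comp (𝟙 A)),
        Category.assoc, eqToHom_trans, eqToHom_trans_assoc] at k
      dsimp only
      rw [QSaux.strip k.symm]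
      simp
    case R₂_whiskerRight =>
      intro A B B' B'' g g' η l e₁ e₂
      have k := h.Φ_natural η (𝟙 l) (𝟙 (𝟙 A)) (𝟙 (𝟙 A))
      simp only [h.cubical_snd, h.tCell_id, id_whiskerRight, whiskerLeft_id,
        Category.comp_id, Category.id_comp, QSaux.tCell_id_right Q.toSemistrictData (Strict.id_comp (𝟙 A)),
        Category.assoc, eqToHom_trans, eqToHom_trans_assoc] at k
      dsimp only
      rw [QSaux.strip k.symm]
      simp
    case L_L => 
      intro A B C C' g
      simpa only [h.tHom_id] using h.tHom_assoc (𝟙 A) (𝟙 B) g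
    case R_R => 
      intro A B C C' g
      simpa only [h.tHom_id] using (h.tHom_assoc g (𝟙 A) (𝟙 B)).symm
    case L_R => 
      intro A B C C' g
      exact (h.tHom_assoc (𝟙 A) g (𝟙 B)).symm
    case L_L₂ =>
      intro A B C C' g g' η
      have k := h.tCell_assoc (𝟙 (𝟙 A)) (𝟙 (𝟙 B)) η
      rw [h.tCell_id, QSaux.tCell_id_left Q.toSemistrictData (h.tHom_id A B),
        QSaux.heq_l, QSaux.heq_r] at k
      exact k
    case R_R₂ =>
      intro A B C C' g g' η
      have k := (h.tCell_assoc η (𝟙 (𝟙 A)) (𝟙 (𝟙 B))).symm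
      rw [h.tCell_id, QSaux.tCell_id_right Q.toSemistrictData (h.tHom_id A B),
        QSaux.heq_l, QSaux.heq_r] at k
      exact k
    case L_R₂ =>
      intro A B C C' f f' η
      exact (h.tCell_assoc (𝟙 (𝟙 A)) η (𝟙 (𝟙 B))).symm
    case L_one => exact h.tHom_one_left
    case R_one => exact h.tHom_one_right
    case L₂_one => exact h.tCell_one_left
    case R₂_one => exact h.tCell_one_right
    case phi_tensor_left =>
      intro A B B' C C' g l
      have k := h.Φ_assoc_compat (𝟙 A) (𝟙 A) (𝟙 B) g l (𝟙 C')
      rw [h.cubical_fst, h.cubical_fst, ← eqToHom_refl (l ≫ 𝟙 C') rfl, QSaux.tCell_eqToHom h,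
        QSaux.tCell_id_left Q.toSemistrictData (Strict.id_comp (𝟙 A)),
        QSaux.Φ_congr Q.toSemistrictData (h.tHom_id A B) rfl rfl rfl] at k
      simp only [QSaux.heq_l, QSaux.heq_r, QSaux.heq_l', QSaux.heq_r'] at k
      simp only [Iso.trans_hom, eqToIso.hom, QSaux.tCell_comp_right, QSaux.heq_l, QSaux.heq_r, QSaux.heq_l', QSaux.heq_r']
      exact k
    case phi_tensor_middle =>
      intro A A' f B C C' l
      have k := h.Φ_assoc_compat (𝟙 A) f (𝟙 B) (𝟙 B) l (𝟙 C')
      rw [h.cubical_snd, h.cubical_fst, ← eqToHom_refl (l ≫ 𝟙 C') rfl, QSaux.tCell_eqToHom h,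
        ← eqToHom_refl (𝟙 A ≫ f) rfl, QSaux.tCell_eqToHom h,
        QSaux.Φ_congr Q.toSemistrictData (h.tHom_id A B) rfl rfl rfl,
        QSaux.Φ_congr Q.toSemistrictData rfl rfl rfl (h.tHom_id B C')] at k
      simp only [QSaux.heq_l, QSaux.heq_r, QSaux.heq_l', QSaux.heq_r'] at k
      simp only [Iso.trans_hom, eqToIso.hom, QSaux.heq_l, QSaux.heq_r, QSaux.heq_l', QSaux.heq_r']
      exact k
    case phi_tensor_right =>
      intro A A' B B' f g C
      have k := (h.Φ_assoc_compat (𝟙 A) f g (𝟙 B') (𝟙 C) (𝟙 C)).symm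
      rw [h.cubical_snd, h.cubical_snd, ← eqToHom_refl (𝟙 A ≫ f) rfl, QSaux.tCell_eqToHom h,
        QSaux.tCell_id_right Q.toSemistrictData (Strict.id_comp (𝟙 C)),
        QSaux.Φ_congr Q.toSemistrictData rfl rfl rfl (h.tHom_id B' C)] at k
      simp only [QSaux.heq_l, QSaux.heq_r, QSaux.heq_l', QSaux.heq_r'] at k
      simp only [Iso.trans_hom, eqToIso.hom, QSaux.tCell_comp_left, QSaux.heq_l, QSaux.heq_r, QSaux.heq_l', QSaux.heq_r']
      exact k
    case phi_id_right =>
      intros; simp [h.cubical_snd]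
    case phi_id_left =>
      intros; simp [h.cubical_fst]
    case phi_natural_fst =>
      intro A A' B B' f f₂ α g
      have k := h.Φ_natural (𝟙 (𝟙 A)) α (𝟙 g) (𝟙 (𝟙 B'))
      simp only [h.tCell_id, id_whiskerRight, whiskerLeft_id, Category.comp_id, Category.id_comp,
        QSaux.id_wl, QSaux.tCell_id_right Q.toSemistrictData (Strict.comp_id g),
        QSaux.tCell_conj_left, QSaux.tCell_R h α g,
        Category.assoc, eqToHom_trans, eqToHom_trans_assoc] at k
      simp only [Iso.trans_hom, eqToIso.hom]
      rw [← Category.assoc (_ ◁ _), k]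
      simp
    case phi_natural_snd =>
      intro A A' B B' f g g₂ θ
      have k := h.Φ_natural (𝟙 (𝟙 A)) (𝟙 f) θ (𝟙 (𝟙 B'))
      simp only [h.tCell_id, id_whiskerRight, whiskerLeft_id, Category.comp_id, Category.id_comp,
        QSaux.wr_id, QSaux.tCell_id_left Q.toSemistrictData (Strict.id_comp f),
        QSaux.tCell_conj_right, QSaux.tCell_L h f θ,
        Category.assoc, eqToHom_trans, eqToHom_trans_assoc] at k
      simp only [Iso.trans_hom, eqToIso.hom]
      rw [← Category.assoc (_ ▷ _), k]
      simp
    case phi_comp_snd =>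
      intros; simp [QSaux.phi_comp_snd h]
    case phi_comp_fst =>
      intros; simp [QSaux.phi_comp_fst h]
  case braid_invol => exact hQ.σ_identity
  case braid_tensor_fst => exact hQ.R_identity
  case braid_tensor_snd => exact hQ.S_identity
  case braid_natural_fst => exact hQ.qs2_snd_eq
  case braid_natural_snd => exact hQ.qs2_fst_eq
  case phi_braid_snd_eq =>
    intro A A' f B C
    exact (hQ.qs3_snd_eq _ _ _).trans (e _ _)
  case phi_braid_fst_eq =>
    intro A A' f B C
    exact (hQ.qs3_fst_eq _ _ _).trans (e _ _)
  case phi_braid_snd =>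
    intros; simp [hQ.qs3_snd]
  case phi_braid_fst =>
    intros; simp [hQ.qs3_fst]
end

section
/- In a stringent monoidal 2-category, the 2-isomorphisms Φ_{(f',g'),(f,g)} := id_{id ⊗ g'} ∗ φ_{f',g} ∗ id_{f ⊗ id} satisfy the pseudofunctor coherence equation: for all composable f : A → A', f' : A' → A'', f'' : A'' → A''' and g : B → B', g' : B' → B'', g'' : B'' → B''', one has Φ_{(f''∘f', g''∘g'), (f,g)} ∘ (Φ_{(f'',g''),(f',g')} whiskered below by f ⊗ g) = Φ_{(f'',g''),(f'∘f, g'∘g)} ∘ (Φ_{(f',g'),(f,g)} whiskered above by f'' ⊗ g''). -/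
open CategoryTheory Bicategory

universe w v u

theorem aux_coh {M : Type u} [Bicategory.{w, v} M] [Bicategory.Strict M]
    {X0 X1 X2 X3 X4 X5 X6 Y1 Y2 Z : M}
    (a : X0 ⟶ X1) (b : X1 ⟶ X2) (c : X2 ⟶ X3) (d : X3 ⟶ X4) (e : X4 ⟶ X5) (k : X5 ⟶ X6)
    (c1 : X1 ⟶ Y1) (b1 : Y1 ⟶ X3) (e1 : X3 ⟶ Y2) (d1 : Y2 ⟶ X5) (e2 : Y1 ⟶ Z) (b2 : Z ⟶ Y2)
    (p : b ≫ c ⟶ c1 ≫ b1) (q : d ≫ e ⟶ e1 ≫ d1) (s : b1 ≫ e1 ⟶ e2 ≫ b2)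
    (ac : X0 ⟶ Y1) (hac : ac = a ≫ c1) (ce : X2 ⟶ Y2) (hce : ce = c ≫ e1)
    (ce' : X1 ⟶ Z) (hce' : ce' = c1 ≫ e2)
    (bd : Y1 ⟶ X4) (hbd : bd = b1 ≫ d) (bd' : Z ⟶ X5) (hbd' : bd' = b2 ≫ d1)
    (dk : Y2 ⟶ X6) (hdk : dk = d1 ≫ k)
    (t : X0 ⟶ X6) (ht : t = a ≫ c1 ≫ e2 ≫ b2 ≫ d1 ≫ k)
    (t' : X0 ⟶ X6) (htt' : t' = t)
    (E0 : ((a ≫ b) ≫ (c ≫ d)) ≫ (e ≫ k) = (a ≫ b) ≫ ((c ≫ d) ≫ (e ≫ k)))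
    (E1 : (c ≫ d) ≫ (e ≫ k) = c ≫ ((d ≫ e) ≫ k))
    (E2 : c ≫ ((e1 ≫ d1) ≫ k) = ce ≫ dk)
    (E3 : (a ≫ b) ≫ (ce ≫ dk) = a ≫ ((b ≫ ce) ≫ dk))
    (E4 : b ≫ ce = (b ≫ c) ≫ e1)
    (E5 : (c1 ≫ b1) ≫ e1 = c1 ≫ (b1 ≫ e1))
    (E6 : c1 ≫ (e2 ≫ b2) = ce' ≫ b2)
    (E7 : a ≫ ((ce' ≫ b2) ≫ dk) = t') (E8 : t' = t)
    (F1 : (a ≫ b) ≫ (c ≫ d) = a ≫ ((b ≫ c) ≫ d))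
    (F2 : a ≫ ((c1 ≫ b1) ≫ d) = ac ≫ bd)
    (F3 : (ac ≫ bd) ≫ (e ≫ k) = ac ≫ ((bd ≫ e) ≫ k))
    (F4 : bd ≫ e = b1 ≫ (d ≫ e))
    (F5 : b1 ≫ (e1 ≫ d1) = (b1 ≫ e1) ≫ d1)
    (F6 : (e2 ≫ b2) ≫ d1 = e2 ≫ bd')
    (F7 : ac ≫ ((e2 ≫ bd') ≫ k) = t) :
    eqToHom E0 ≫ ((a ≫ b) ◁ (eqToHom E1 ≫ (c ◁ (q ▷ k)) ≫ eqToHom E2)) ≫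
      (eqToHom E3 ≫ (a ◁ ((eqToHom E4 ≫ (p ▷ e1) ≫ eqToHom E5 ≫ (c1 ◁ s) ≫ eqToHom E6) ▷ dk))
        ≫ eqToHom E7) ≫ eqToHom E8
    = ((eqToHom F1 ≫ (a ◁ (p ▷ d)) ≫ eqToHom F2) ▷ (e ≫ k)) ≫
      (eqToHom F3 ≫ (ac ◁ ((eqToHom F4 ≫ (b1 ◁ q) ≫ eqToHom F5 ≫ (s ▷ d1) ≫ eqToHom F6) ▷ k))
        ≫ eqToHom F7) := by
  subst hac hce hce' hbd hbd' hdk htt' ht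
  have key := congrArg (fun z => eqToHom (show ((a ≫ b) ≫ (c ≫ d)) ≫ (e ≫ k) =
      a ≫ ((b ≫ c) ≫ (d ≫ e)) ≫ k by simp only [Strict.assoc]) ≫ (a ◁ (z ▷ k)) ≫
    eqToHom (show a ≫ ((c1 ≫ b1) ≫ (e1 ≫ d1)) ≫ k = a ≫ c1 ≫ ((b1 ≫ e1) ≫ d1) ≫ k by
      simp only [Strict.assoc]) ≫ a ◁ c1 ◁ s ▷ d1 ▷ k ≫
    eqToHom (show a ≫ c1 ≫ ((e2 ≫ b2) ≫ d1) ≫ k = a ≫ c1 ≫ e2 ≫ b2 ≫ d1 ≫ k by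
      simp only [Strict.assoc])) (whisker_exchange p q)
  simp only [Strict.associator_eqToIso, eqToIso.hom, eqToIso.inv, comp_whiskerLeft,
    whiskerRight_comp, comp_whiskerRight, whiskerLeft_comp, whisker_assoc,
    whiskerLeft_eqToHom, eqToHom_whiskerRight, Category.assoc, eqToHom_trans, eqToHom_trans_assoc] at key
  simp only [Strict.associator_eqToIso, eqToIso.hom, eqToIso.inv, comp_whiskerLeft,
    whiskerRight_comp, comp_whiskerRight, whiskerLeft_comp, whisker_assoc,
    whiskerLeft_eqToHom, eqToHom_whiskerRight, Category.assoc, eqToHom_trans, eqToHom_trans_assoc]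
  exact key

/-- In a stringent monoidal 2-category, the 2-isomorphisms
`Φ_{(f',g'),(f,g)} := id_{id ⊗ g'} ∗ φ_{f',g} ∗ id_{f ⊗ id}` (where
`f ⊗ g := (id_{A'} ⊗ g) ∘ (f ⊗ id_B)`) satisfy the pseudofunctor coherence equation. -/
theorem stringent_extension_coherence
    {M : Type u} [Bicategory.{w, v} M] [Bicategory.Strict M]
    (D : StringentData M) (hD : IsStringent D)
    -- the tensor product of 1-morphisms
    (T : ∀ {A A' B B' : M}, (A ⟶ A') → (B ⟶ B') → (D.t A B ⟶ D.t A' B'))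
    (hT : ∀ {A A' B B' : M} (f : A ⟶ A') (g : B ⟶ B'), T f g = D.R B f ≫ D.L A' g)
    -- the extension of the interchangor to composition coherence 2-isomorphisms
    (Φ : ∀ {A A' A'' B B' B'' : M} (f : A ⟶ A') (f' : A' ⟶ A'') (g : B ⟶ B') (g' : B' ⟶ B''),
      T f g ≫ T f' g' ⟶ T (f ≫ f') (g ≫ g'))
    (hΦ : ∀ {A A' A'' B B' B'' : M} (f : A ⟶ A') (f' : A' ⟶ A'') (g : B ⟶ B') (g' : B' ⟶ B'')
      (e₁ : T f g ≫ T f' g' = D.R B f ≫ ((D.L A' g ≫ D.R B' f') ≫ D.L A'' g'))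
      (e₂ : D.R B f ≫ ((D.R B f' ≫ D.L A'' g) ≫ D.L A'' g') = T (f ≫ f') (g ≫ g')),
      Φ f f' g g'
        = eqToHom e₁ ≫ (D.R B f ◁ ((D.φ f' g).hom ▷ D.L A'' g')) ≫ eqToHom e₂) :
    -- the pseudofunctor coherence equation
    ∀ {A A' A'' A''' B B' B'' B''' : M}
      (f : A ⟶ A') (f' : A' ⟶ A'') (f'' : A'' ⟶ A''')
      (g : B ⟶ B') (g' : B' ⟶ B'') (g'' : B'' ⟶ B''')
      (E₀ : (T f g ≫ T f' g') ≫ T f'' g'' = T f g ≫ (T f' g' ≫ T f'' g''))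
      (E₁ : T (f ≫ f' ≫ f'') (g ≫ g' ≫ g'') = T ((f ≫ f') ≫ f'') ((g ≫ g') ≫ g'')),
      eqToHom E₀ ≫ (T f g ◁ Φ f' f'' g' g'') ≫ Φ f (f' ≫ f'') g (g' ≫ g'') ≫ eqToHom E₁
        = (Φ f f' g g' ▷ T f'' g'') ≫ Φ (f ≫ f') f'' (g ≫ g') g'' := by
  have hT' : @T = fun {A A' B B'} f g => D.R B f ≫ D.L A' g := by
    funext A A' B B' f g; exact hT f g
  subst hT'
  intro A A' A'' A''' B B' B'' B''' f f' f'' g g' g'' E₀ E₁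
  rw [hΦ f' f'' g' g'' (by simp only [Strict.assoc])
      (by simp only [Strict.assoc, hD.L_comp, hD.R_comp]),
    hΦ f (f' ≫ f'') g (g' ≫ g'') (by simp only [Strict.assoc])
      (by simp only [Strict.assoc, hD.L_comp, hD.R_comp]),
    hΦ f f' g g' (by simp only [Strict.assoc])
      (by simp only [Strict.assoc, hD.L_comp, hD.R_comp]),
    hΦ (f ≫ f') f'' (g ≫ g') g'' (by simp only [Strict.assoc])
      (by simp only [Strict.assoc, hD.L_comp, hD.R_comp]),
    hD.phi_comp_fst f' f'' g (by simp only [Strict.assoc, hD.R_comp]) (by simp only [Strict.assoc])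
      (by simp only [Strict.assoc, hD.R_comp]),
    hD.phi_comp_snd f'' g g' (by simp only [Strict.assoc, hD.L_comp]) (by simp only [Strict.assoc])
      (by simp only [Strict.assoc, hD.L_comp])]
  refine aux_coh (D.R B f) (D.L A' g) (D.R B' f') (D.L A'' g') (D.R B'' f'') (D.L A''' g'')
    (D.R B f') (D.L A'' g) (D.R B' f'') (D.L A''' g') (D.R B f'') (D.L A''' g)
    (D.φ f' g).hom (D.φ f'' g').hom (D.φ f'' g).hom
    _ (hD.R_comp _ _ _) _ (hD.R_comp _ _ _) _ (hD.R_comp _ _ _) _ (hD.L_comp _ _ _)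
    _ (hD.L_comp _ _ _) _ (hD.L_comp _ _ _) _ ?_ _ ?_ _ _ _ _ _ _ _ _ _ _ _ _ _ _ _ _
  · simp only [Strict.assoc, hD.L_comp, hD.R_comp]
  · simp only [Strict.assoc, hD.L_comp, hD.R_comp]
end
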